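/- arXiv:2302.14407 — 13 statements merged into one kernel-verified Lean document; each statement's English description precedes it below -/
import Mathlib

section
/- Let n ≥ 2 be an integer and x_1, …, x_n real numbers with ℓ := min_s x_s strictly less than u := max_s x_s. Let k be a real number with n + k > 2. Then the iterated integral over σ ∈ (0,∞) and μ ∈ ℝ of σ^{−k} · ∏_{s=1}^n (1/σ)·𝟙[μ − σ/2 ≤ x_s ≤ μ + σ/2] equals 1/((n+k−1)(n+k−2)(u−ℓ)^{n+k−2}). -/
open MeasureTheory Set

/-- The product of uniform likelihoods on `[m - σ/2, m + σ/2]`, as a function of `m`, is a constant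
multiple of the indicator of the interval of midpoints compatible with all the data. -/
lemma prod_uniform_likelihood_eq_indicator {ι : Type*} [Fintype ι] [Nonempty ι] (x : ι → ℝ)
    (σ m : ℝ) :
    ∏ s, (σ⁻¹ * if m - σ / 2 ≤ x s ∧ x s ≤ m + σ / 2 then (1 : ℝ) else 0)
      = (Icc ((⨆ s, x s) - σ / 2) ((⨅ s, x s) + σ / 2)).indicator
          (fun _ => σ⁻¹ ^ Fintype.card ι) m := by
  have hmem : m ∈ Icc ((⨆ s, x s) - σ / 2) ((⨅ s, x s) + σ / 2) ↔
      ∀ s, m - σ / 2 ≤ x s ∧ x s ≤ m + σ / 2 := by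
    rw [mem_Icc, sub_le_iff_le_add, ← sub_le_iff_le_add (a := m),
      ciSup_le_iff (finite_range x).bddAbove, le_ciInf_iff (finite_range x).bddBelow, forall_and,
      and_comm]
  rw [Finset.prod_mul_distrib, Finset.prod_const, Finset.card_univ, Finset.prod_boole,
    indicator_apply]
  simp [hmem]

/-- Integrating the likelihood over the location `m`. -/
lemma integral_prod_uniform_likelihood {ι : Type*} [Fintype ι] [Nonempty ι] (x : ι → ℝ)
    (σ : ℝ) :
    ∫ m : ℝ, ∏ s, (σ⁻¹ * if m - σ / 2 ≤ x s ∧ x s ≤ m + σ / 2 then (1 : ℝ) else 0)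
      = max (σ - ((⨆ s, x s) - ⨅ s, x s)) 0 * σ⁻¹ ^ Fintype.card ι := by
  simp_rw [prod_uniform_likelihood_eq_indicator]
  rw [integral_indicator_const _ measurableSet_Icc, Real.volume_real_Icc, smul_eq_mul]
  congr 2
  ring

lemma integral_Ioi_rpow_neg_mul_sub {d p : ℝ} (hd : 0 < d) (hp : 2 < p) :
    ∫ σ in Ioi d, σ ^ (-p) * (σ - d) = 1 / ((p - 1) * (p - 2) * d ^ (p - 2)) := by
  have hsplit : EqOn (fun σ : ℝ => σ ^ (-p) * (σ - d))
      (fun σ => σ ^ (1 - p) - d * σ ^ (-p)) (Ioi d) := by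
    intro σ hσ
    have hσ0 : σ ≠ 0 := (hd.trans hσ).ne'
    simp only
    rw [show 1 - p = -p + 1 by ring, Real.rpow_add_one hσ0]
    ring
  rw [setIntegral_congr_fun measurableSet_Ioi hsplit,
    integral_sub (integrableOn_Ioi_rpow_of_lt (by linarith) hd)
      ((integrableOn_Ioi_rpow_of_lt (by linarith) hd).const_mul d),
    integral_const_mul, integral_Ioi_rpow_of_lt (by linarith) hd,
    integral_Ioi_rpow_of_lt (by linarith) hd,
    show 1 - p + 1 = -(p - 2) by ring, show -p + 1 = -(p - 2) - 1 by ring,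
    Real.rpow_sub_one hd.ne', Real.rpow_neg hd.le]
  have h1 : p - 1 ≠ 0 := by linarith
  have h2 : p - 2 ≠ 0 := by linarith
  have h3 : d ^ (p - 2) ≠ 0 := (Real.rpow_pos_of_pos hd _).ne'
  rw [show -(p - 2) - 1 = -(p - 1) by ring]
  field_simp
  ring

/-- Normalizing constant of the posterior in the uniform bandit model with
prior `σ^(-k)`: the integral over `σ ∈ (0,∞)` and `μ ∈ ℝ` of
`σ^(-k) · ∏ (1/σ)·𝟙[μ - σ/2 ≤ x_s ≤ μ + σ/2]` equals
`1/((n+k-1)(n+k-2)(u-ℓ)^(n+k-2))` where `ℓ` and `u` are the min and max of the data. -/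
theorem stmt_2 (n : ℕ) (hn : 2 ≤ n) (x : Fin n → ℝ) (k : ℝ)
    (hk : 2 < (n : ℝ) + k) (hlu : (⨅ s, x s) < ⨆ s, x s) :
    (∫ σ in Set.Ioi (0 : ℝ), ∫ m : ℝ,
      σ ^ (-k) * ∏ s : Fin n,
        (σ⁻¹ * if m - σ/2 ≤ x s ∧ x s ≤ m + σ/2 then (1 : ℝ) else 0))
    = 1 / (((n : ℝ) + k - 1) * ((n : ℝ) + k - 2)
        * ((⨆ s, x s) - ⨅ s, x s) ^ ((n : ℝ) + k - 2)) := by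
  have : Nonempty (Fin n) := ⟨⟨0, by lia⟩⟩
  have hd : 0 < (⨆ s, x s) - ⨅ s, x s := sub_pos.2 hlu
  simp_rw [integral_const_mul, integral_prod_uniform_likelihood, Fintype.card_fin]
  rw [← integral_Ioi_rpow_neg_mul_sub hd hk]
  set d := (⨆ s, x s) - ⨅ s, x s
  rw [setIntegral_eq_of_subset_of_forall_sdiff_eq_zero (s := Ioi d) measurableSet_Ioi
    (Ioi_subset_Ioi hd.le)]
  · refine setIntegral_congr_fun measurableSet_Ioi fun σ hσ => ?_
    have hσ0 : 0 < σ := hd.trans hσ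
    rw [max_eq_left (sub_nonneg.2 (le_of_lt hσ)), neg_add, Real.rpow_add hσ0,
      Real.rpow_neg hσ0.le n, Real.rpow_natCast, inv_pow]
    ring
  · rintro σ ⟨-, hσ⟩
    rw [max_eq_right (sub_nonpos.2 (notMem_Ioi.1 hσ))]
    simp
end

section
/- Let p > 0, σ̂ > 0, ℓ ∈ ℝ, and let τ be a real number with τ ≥ ℓ + σ̂. Then ∫_{s ∈ (σ̂, ∞)} p(p+1)·σ̂^p · max(0, ℓ + s/2 − τ) · s^{−(p+2)} ds = (1/2)·(σ̂/(2(τ − ℓ)))^p. -/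
open MeasureTheory Set

/-- The first moment of `s - c` against the power weight `s ^ (-(p + 2))` on `(c, ∞)`. -/
theorem integral_Ioi_sub_mul_rpow {p c : ℝ} (hp : 0 < p) (hc : 0 < c) :
    ∫ s in Ioi c, (s - c) * s ^ (-(p + 2)) = c ^ (-p) / (p * (p + 1)) := by
  have split : EqOn (fun s : ℝ ↦ (s - c) * s ^ (-(p + 2)))
      (fun s ↦ s ^ (-(p + 1)) - c * s ^ (-(p + 2))) (Ioi c) := by
    intro s hs
    have hs0 : s ≠ 0 := (hc.trans hs).ne'
    have h : s ^ (-(p + 1)) = s ^ (-(p + 2)) * s := by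
      rw [← Real.rpow_add_one hs0]; ring_nf
    simp only [h]
    ring
  rw [setIntegral_congr_fun measurableSet_Ioi split,
    integral_sub (integrableOn_Ioi_rpow_of_lt (by linarith) hc)
      ((integrableOn_Ioi_rpow_of_lt (by linarith) hc).const_mul c),
    integral_const_mul, integral_Ioi_rpow_of_lt (by linarith) hc,
    integral_Ioi_rpow_of_lt (by linarith) hc,
    show -(p + 1) + 1 = -p by ring, show -(p + 2) + 1 = -(p + 1) by ring]
  have h : c ^ (-p) = c ^ (-(p + 1)) * c := by
    rw [← Real.rpow_add_one hc.ne']; ring_nf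
  rw [h]
  have hp1 : p + 1 ≠ 0 := by positivity
  field_simp
  ring

/-- Posterior tail probability in the uniform bandit model: for `p > 0`,
`σ̂ > 0` and a threshold `τ ≥ ℓ + σ̂`,
`∫_{σ̂}^{∞} p(p+1) σ̂^p max(0, ℓ + s/2 - τ) s^{-(p+2)} ds = (1/2)(σ̂/(2(τ-ℓ)))^p`. -/
theorem stmt_3 (p σhat ℓ τ : ℝ) (hp : 0 < p) (hσ : 0 < σhat)
    (hτ : ℓ + σhat ≤ τ) :
    (∫ s in Set.Ioi σhat,
      p * (p + 1) * σhat ^ p * max 0 (ℓ + s/2 - τ) * s ^ (-(p + 2)))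
    = (1/2) * (σhat / (2 * (τ - ℓ))) ^ p := by
  have hc : 0 < 2 * (τ - ℓ) := by linarith
  have hsub : Ioi (2 * (τ - ℓ)) ⊆ Ioi σhat := Ioi_subset_Ioi (by linarith)
  have hzero : ∀ s ∈ Ioi σhat \ Ioi (2 * (τ - ℓ)),
      p * (p + 1) * σhat ^ p * max 0 (ℓ + s/2 - τ) * s ^ (-(p + 2)) = 0 := by
    rintro s ⟨-, hs⟩
    rw [mem_Ioi, not_lt] at hs
    rw [max_eq_left (by linarith)]
    ring
  have hpos : EqOn (fun s ↦ p * (p + 1) * σhat ^ p * max 0 (ℓ + s/2 - τ) * s ^ (-(p + 2)))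
      (fun s ↦ p * (p + 1) * σhat ^ p / 2 * ((s - 2 * (τ - ℓ)) * s ^ (-(p + 2))))
      (Ioi (2 * (τ - ℓ))) := by
    intro s hs
    rw [mem_Ioi] at hs
    simp only [max_eq_right (show 0 ≤ ℓ + s/2 - τ by linarith)]
    ring
  rw [setIntegral_eq_of_subset_of_forall_sdiff_eq_zero measurableSet_Ioi hsub hzero,
    setIntegral_congr_fun measurableSet_Ioi hpos, integral_const_mul,
    integral_Ioi_sub_mul_rpow hp hc, Real.div_rpow hσ.le hc.le, Real.rpow_neg hc.le]
  field_simp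
end

section
/- Let n ≥ 2 be an integer, k a real number with n + k > 1, σ > 0, ε ∈ (0, σ/2), and μ ∈ ℝ. Then ∫_{y = μ−σ/2}^{μ−ε} ∫_{z = y}^{y + 1/n} (n(n−1)/σ^n) · (2n(μ − ε − y))^{n+k−2} · (z − y)^{n−2} dz dy = (1/2) · (n^k/(n+k−1)) · (σ − 2ε)^{k−1} · ((σ − 2ε)/σ)^n, and this quantity is at most (1/2) · (n^k/(n+k−1)) · (σ − 2ε)^{k−1} · exp(−2εn/σ). -/
open MeasureTheory Set

theorem setIntegral_Icc_sub_left_rpow {a h r : ℝ} (hh : 0 ≤ h) (hr : -1 < r) :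
    ∫ z in Set.Icc a (a + h), (z - a) ^ r = h ^ (r + 1) / (r + 1) := by
  rw [integral_Icc_eq_integral_Ioc, ← intervalIntegral.integral_of_le (by linarith),
    intervalIntegral.integral_comp_sub_right (fun x => x ^ r), sub_self, add_sub_cancel_left,
    integral_rpow (Or.inl hr), Real.zero_rpow (by linarith), sub_zero]

theorem setIntegral_Icc_sub_right_rpow {a b r : ℝ} (hab : a ≤ b) (hr : -1 < r) :
    ∫ y in Set.Icc a b, (b - y) ^ r = (b - a) ^ (r + 1) / (r + 1) := by
  rw [integral_Icc_eq_integral_Ioc, ← intervalIntegral.integral_of_le hab,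
    intervalIntegral.integral_comp_sub_left (fun x => x ^ r), sub_self,
    integral_rpow (Or.inl hr), Real.zero_rpow (by linarith), sub_zero]

theorem setIntegral_Icc_mul_sub_right_rpow {a b c r : ℝ} (hab : a ≤ b) (hc : 0 ≤ c)
    (hr : -1 < r) :
    ∫ y in Set.Icc a b, (c * (b - y)) ^ r = c ^ r * ((b - a) ^ (r + 1) / (r + 1)) := by
  rw [← setIntegral_Icc_sub_right_rpow hab hr, ← integral_const_mul]
  exact setIntegral_congr_fun measurableSet_Icc fun y hy =>
    Real.mul_rpow hc (sub_nonneg.2 hy.2)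

theorem div_pow_le_exp_neg {σ δ : ℝ} (hσ : 0 < σ) (hδ : δ ≤ σ) (n : ℕ) :
    ((σ - δ) / σ) ^ n ≤ Real.exp (-(δ * n / σ)) := by
  have h : (σ - δ) / σ ≤ Real.exp (-(δ / σ)) := by
    have := Real.one_sub_le_exp_neg (δ / σ)
    rwa [sub_div, div_self hσ.ne']
  calc ((σ - δ) / σ) ^ n ≤ Real.exp (-(δ / σ)) ^ n :=
        pow_le_pow_left₀ (div_nonneg (sub_nonneg.2 hδ) hσ.le) h n
    _ = Real.exp (-(δ * n / σ)) := by
        rw [← Real.exp_nat_mul]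
        congr 1
        ring

/-- The extra term introduced by the truncation procedure of TS-T in the
uniform bandit model: exact evaluation of the double integral and its
exponential bound. -/
theorem stmt_4 (n : ℕ) (hn : 2 ≤ n) (k σ ε μ : ℝ) (hk : 1 < (n : ℝ) + k)
    (hσ : 0 < σ) (hε : 0 < ε) (hεσ : ε < σ/2) :
    (∫ y in Set.Icc (μ - σ/2) (μ - ε), ∫ z in Set.Icc y (y + 1/(n : ℝ)),
        ((n : ℝ) * ((n : ℝ) - 1) / σ ^ n)
          * (2 * (n : ℝ) * (μ - ε - y)) ^ ((n : ℝ) + k - 2)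
          * (z - y) ^ ((n : ℝ) - 2))
      = (1/2) * ((n : ℝ) ^ k / ((n : ℝ) + k - 1)) * (σ - 2*ε) ^ (k - 1)
          * ((σ - 2*ε)/σ) ^ n ∧
    (1/2) * ((n : ℝ) ^ k / ((n : ℝ) + k - 1)) * (σ - 2*ε) ^ (k - 1)
        * ((σ - 2*ε)/σ) ^ n
      ≤ (1/2) * ((n : ℝ) ^ k / ((n : ℝ) + k - 1)) * (σ - 2*ε) ^ (k - 1)
          * Real.exp (-(2 * ε * n / σ)) := by
  have hn2 : (2 : ℝ) ≤ n := by exact_mod_cast hn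
  have hn0 : (0 : ℝ) < n := by linarith
  have hS : 0 < σ - 2 * ε := by linarith
  constructor
  · have inner (y : ℝ) : ∫ z in Set.Icc y (y + 1/(n : ℝ)),
        ((n : ℝ) * ((n : ℝ) - 1) / σ ^ n)
          * (2 * (n : ℝ) * (μ - ε - y)) ^ ((n : ℝ) + k - 2)
          * (z - y) ^ ((n : ℝ) - 2)
        = ((n : ℝ) * ((n : ℝ) - 1) / σ ^ n) * ((1/(n : ℝ)) ^ ((n : ℝ) - 1) / ((n : ℝ) - 1))
          * (2 * (n : ℝ) * (μ - ε - y)) ^ ((n : ℝ) + k - 2) := by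
      rw [integral_const_mul, setIntegral_Icc_sub_left_rpow (by positivity) (by linarith),
        show (n : ℝ) - 2 + 1 = n - 1 by ring]
      ring
    simp_rw [inner]
    rw [integral_const_mul, setIntegral_Icc_mul_sub_right_rpow (by linarith) (by positivity)
      (by linarith), show μ - ε - (μ - σ/2) = (σ - 2 * ε) / 2 by ring,
      show (n : ℝ) + k - 2 + 1 = n + k - 1 by ring]
    generalize σ - 2 * ε = S at hS ⊢
    have hn1 : (n : ℝ) - 1 ≠ 0 := by linarith
    have hk1 : (n : ℝ) + k - 1 ≠ 0 := by linarith
    rw [Real.div_rpow zero_le_one hn0.le, Real.one_rpow, Real.mul_rpow zero_le_two hn0.le,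
      Real.div_rpow hS.le zero_le_two, div_pow,
      show (n : ℝ) + k - 2 = (n + k - 1) - 1 by ring, Real.rpow_sub_one two_ne_zero,
      show (n : ℝ) + k - 1 - 1 = (n - 1) + (k - 1) by ring, Real.rpow_add hn0,
      Real.rpow_sub_one hn0.ne' k]
    rw [show S ^ ((n : ℝ) + k - 1) = S ^ (k - 1) * S ^ n by
      rw [← Real.rpow_natCast S n, ← Real.rpow_add hS]
      congr 1
      ring]
    have h2 : (2 : ℝ) ^ ((n : ℝ) + k - 1) ≠ 0 := by positivity
    have hnn : (n : ℝ) ^ ((n : ℝ) - 1) ≠ 0 := by positivity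
    field_simp
  · have hk1 : 0 < (n : ℝ) + k - 1 := by linarith
    exact mul_le_mul_of_nonneg_left (div_pow_le_exp_neg hσ (by linarith) n) (by positivity)
end

section
/- Let k ∈ {1, 2} and let n be an integer with n ≥ max(2, 4 − k). Then ∫_0^1 w^{−1/2}(1−w)^{−(k+1)/2} Γ(n/2, 1/(2(1−w))) dw ≤ Γ(n/2) · ∫_0^1 w^{−1/2}(1−w)^{−1 + 2·n^{−(k+1)/2}} dw = Γ(n/2) · B(1/2, 2·n^{−(k+1)/2}). -/
open MeasureTheory Set

/-- The upper incomplete gamma function `Γ(s, x) = ∫_x^∞ t^(s-1) e^(-t) dt`. -/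
noncomputable def uGamma (s x : ℝ) : ℝ := ∫ t in Set.Ioi x, t ^ (s - 1) * Real.exp (-t)

/-- The Beta function `B(a,b) = Γ(a)Γ(b)/Γ(a+b)`. -/
noncomputable def Beta (a b : ℝ) : ℝ :=
  Real.Gamma a * Real.Gamma b / Real.Gamma (a + b)

/-- The real Beta integral converges and is given by `Beta`. -/
lemma integrableOn_beta_and_integral_eq {a b : ℝ} (ha : 0 < a) (hb : 0 < b) :
    IntegrableOn (fun w : ℝ => w ^ (a - 1) * (1 - w) ^ (b - 1)) (Ioo 0 1) ∧
      ∫ w in Ioo (0 : ℝ) 1, w ^ (a - 1) * (1 - w) ^ (b - 1) = Beta a b := by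
  have h := Complex.betaIntegral_convergent (u := a) (v := b) (by simpa) (by simpa)
  rw [intervalIntegrable_iff_integrableOn_Ioc_of_le zero_le_one,
    integrableOn_Ioc_iff_integrableOn_Ioo] at h
  have e : EqOn (fun x : ℝ => (x : ℂ) ^ ((a : ℂ) - 1) * (1 - (x : ℂ)) ^ ((b : ℂ) - 1))
      (fun x : ℝ => ((x ^ (a - 1) * (1 - x) ^ (b - 1) : ℝ) : ℂ)) (Ioo 0 1) := by
    intro x hx
    simp only [Complex.ofReal_mul]
    rw [Complex.ofReal_cpow hx.1.le, Complex.ofReal_cpow (by linarith [hx.2])]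
    push_cast
    rfl
  refine ⟨?_, ?_⟩
  · have h2 := (h.congr_fun e measurableSet_Ioo).re
    simpa [IntegrableOn] using h2
  · have h3 := ProbabilityTheory.beta_eq_betaIntegralReal a b ha hb
    rw [Complex.betaIntegral, intervalIntegral.integral_of_le zero_le_one,
      integral_Ioc_eq_integral_Ioo, setIntegral_congr_fun measurableSet_Ioo e,
      integral_complex_ofReal, Complex.ofReal_re] at h3
    exact h3.symm

/-- The lower bound `1 / b + 1 ≤ B(1/2, b)` for `0 < b ≤ 1`. -/
lemma one_div_add_one_le_integral_beta {b : ℝ} (hb : 0 < b) (hb1 : b ≤ 1) :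
    1 / b + 1 ≤ ∫ w in Ioo (0 : ℝ) 1, w ^ ((1 / 2 : ℝ) - 1) * (1 - w) ^ (b - 1) := by
  have hi := (integrableOn_beta_and_integral_eq (a := 1 / 2) (by norm_num) hb).1
  have i1 : IntervalIntegrable (fun w : ℝ => (1 - w) ^ (b - 1)) volume 0 1 := by
    have := (intervalIntegral.intervalIntegrable_rpow' (a := 1) (b := 0) (r := b - 1)
      (by linarith)).comp_sub_left 1
    simpa using this
  have i2 : IntervalIntegrable (fun w : ℝ => w ^ ((1 / 2 : ℝ) - 1)) volume 0 1 :=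
    intervalIntegral.intervalIntegrable_rpow' (by norm_num)
  have e1 : ∫ w in (0 : ℝ)..1, (1 - w) ^ (b - 1) = 1 / b := by
    rw [intervalIntegral.integral_comp_sub_left (fun x : ℝ => x ^ (b - 1)) 1,
      integral_rpow (Or.inl (by linarith))]
    simp [Real.zero_rpow hb.ne']
  have e2 : ∫ w in (0 : ℝ)..1, w ^ ((1 / 2 : ℝ) - 1) = 2 := by
    rw [integral_rpow (Or.inl (by norm_num))]
    norm_num
  have e3 : ∫ w in (0 : ℝ)..1, ((1 - w) ^ (b - 1) + (w ^ ((1 / 2 : ℝ) - 1) - 1)) = 1 / b + 1 := by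
    rw [intervalIntegral.integral_add i1 (i2.sub intervalIntegrable_const),
      intervalIntegral.integral_sub i2 intervalIntegrable_const, e1, e2]
    norm_num
  have i3 := i1.add (i2.sub (intervalIntegrable_const (c := (1 : ℝ))))
  rw [intervalIntegrable_iff_integrableOn_Ioc_of_le zero_le_one,
    integrableOn_Ioc_iff_integrableOn_Ioo] at i3
  rw [← e3, intervalIntegral.integral_of_le zero_le_one, integral_Ioc_eq_integral_Ioo]
  refine setIntegral_mono_on i3 hi measurableSet_Ioo fun w hw => ?_
  have h1 : 1 ≤ w ^ ((1 / 2 : ℝ) - 1) :=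
    Real.one_le_rpow_of_pos_of_le_one_of_nonpos hw.1 hw.2.le (by norm_num)
  have h2 : 1 ≤ (1 - w) ^ (b - 1) :=
    Real.one_le_rpow_of_pos_of_le_one_of_nonpos (by linarith [hw.2]) (by linarith [hw.1])
      (by linarith)
  nlinarith [mul_nonneg (sub_nonneg.2 h1) (sub_nonneg.2 h2)]

/-- The first two moments of the Gamma distribution, combined linearly. -/
lemma integrableOn_and_integral_gamma_affine {s : ℝ} (hs : 0 < s) (a c : ℝ) :
    IntegrableOn (fun t : ℝ => t ^ (s - 1) * Real.exp (-t) * (a + c * t)) (Ioi 0) ∧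
      ∫ t in Ioi (0 : ℝ), t ^ (s - 1) * Real.exp (-t) * (a + c * t)
        = Real.Gamma s * (a + c * s) := by
  have i0 := Real.GammaIntegral_convergent hs
  have i1 := Real.GammaIntegral_convergent (s := s + 1) (by linarith)
  have e : EqOn (fun t : ℝ => a * (Real.exp (-t) * t ^ (s - 1))
      + c * (Real.exp (-t) * t ^ (s + 1 - 1)))
      (fun t : ℝ => t ^ (s - 1) * Real.exp (-t) * (a + c * t)) (Ioi 0) := by
    intro t ht
    have : t ^ (s + 1 - 1) = t ^ (s - 1) * t := by
      rw [← Real.rpow_add_one (ne_of_gt ht)]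
      ring_nf
    simp only [this]
    ring
  refine ⟨IntegrableOn.congr_fun ((i0.const_mul a).add (i1.const_mul c)) e measurableSet_Ioi, ?_⟩
  rw [← setIntegral_congr_fun measurableSet_Ioi e,
    integral_add (i0.const_mul a) (i1.const_mul c), integral_const_mul, integral_const_mul,
    ← Real.Gamma_eq_integral hs, ← Real.Gamma_eq_integral (by linarith), Real.Gamma_add_one hs.ne']
  ring

/-- Fubini bound for integrals against the upper incomplete Gamma function. -/
lemma integral_mul_uGamma_le {g : ℝ → ℝ} (hg : Measurable g) (hg0 : ∀ w ∈ Ioo (0 : ℝ) 1, 0 ≤ g w)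
    {s a c : ℝ} (hs : 0 < s) (ha : 0 ≤ a) (hc : 0 ≤ c)
    (hG : ∀ t : ℝ, 1 / 2 < t →
      ∫⁻ w in Ioo (0 : ℝ) (1 - 1 / (2 * t)), ENNReal.ofReal (g w) ≤ ENNReal.ofReal (a + c * t)) :
    ∫ w in Ioo (0 : ℝ) 1, g w * uGamma s (1 / (2 * (1 - w))) ≤ Real.Gamma s * (a + c * s) := by
  have hR : 0 ≤ Real.Gamma s * (a + c * s) :=
    mul_nonneg (Real.Gamma_pos_of_pos hs).le (by positivity)
  by_cases hint : IntegrableOn (fun w => g w * uGamma s (1 / (2 * (1 - w)))) (Ioo 0 1)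
  swap
  · rw [integral_undef hint]
    exact hR
  have hu : ∀ x : ℝ, 0 < x → 0 ≤ uGamma s x := fun x hx =>
    setIntegral_nonneg measurableSet_Ioi fun t ht =>
      mul_nonneg (Real.rpow_nonneg (hx.trans ht).le _) (Real.exp_pos _).le
  have hpi : IntegrableOn (fun t : ℝ => t ^ (s - 1) * Real.exp (-t)) (Ioi 0) := by
    simpa using (integrableOn_and_integral_gamma_affine hs 1 0).1
  have hpm : Measurable fun t : ℝ => ENNReal.ofReal (t ^ (s - 1) * Real.exp (-t)) := by fun_prop
  have hgm : Measurable fun w : ℝ => ENNReal.ofReal (g w) := by fun_prop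
  let S : Set (ℝ × ℝ) := {z | 1 / (2 * (1 - z.1)) < z.2}
  have hS : MeasurableSet S := measurableSet_lt (by fun_prop) (by fun_prop)
  let f : ℝ → ℝ → ENNReal := fun w t => S.indicator
    (fun z => ENNReal.ofReal (g z.1) * ENNReal.ofReal (z.2 ^ (s - 1) * Real.exp (-z.2))) (w, t)
  have hf : Measurable (Function.uncurry f) :=
    Measurable.indicator (by fun_prop) hS
  rw [← ENNReal.ofReal_le_ofReal_iff hR, ofReal_integral_eq_lintegral_ofReal hint
    (ae_restrict_of_forall_mem measurableSet_Ioo fun w hw =>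
      mul_nonneg (hg0 w hw) (hu _ (by have := hw.2; simp; linarith)))]
  calc ∫⁻ w in Ioo (0 : ℝ) 1, ENNReal.ofReal (g w * uGamma s (1 / (2 * (1 - w))))
      = ∫⁻ w in Ioo (0 : ℝ) 1, ∫⁻ t in Ioi (0 : ℝ), f w t := by
        refine setLIntegral_congr_fun measurableSet_Ioo fun w hw => ?_
        have hx : 0 < 1 / (2 * (1 - w)) := by have := hw.2; simp; linarith
        have hfi : ∀ t, f w t = (Ioi (1 / (2 * (1 - w)))).indicator
            (fun t => ENNReal.ofReal (g w) * ENNReal.ofReal (t ^ (s - 1) * Real.exp (-t))) t :=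
          fun t => rfl
        simp only [hfi]
        rw [setLIntegral_indicator measurableSet_Ioi, Ioi_inter_Ioi, sup_of_le_left hx.le,
          lintegral_const_mul _ hpm, ENNReal.ofReal_mul (hg0 w hw), uGamma,
          ofReal_integral_eq_lintegral_ofReal (hpi.mono_set (Ioi_subset_Ioi hx.le))
          (ae_restrict_of_forall_mem measurableSet_Ioi fun t ht =>
            mul_nonneg (Real.rpow_nonneg (hx.trans ht).le _) (Real.exp_pos _).le)]
    _ = ∫⁻ t in Ioi (0 : ℝ), ∫⁻ w in Ioo (0 : ℝ) 1, f w t :=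
        lintegral_lintegral_swap hf.aemeasurable
    _ ≤ ∫⁻ t in Ioi (0 : ℝ), ENNReal.ofReal (t ^ (s - 1) * Real.exp (-t) * (a + c * t)) := by
        refine setLIntegral_mono' measurableSet_Ioi fun t ht => ?_
        have ht0 : 0 < t := ht
        have hle : ∫⁻ w in Ioo (0 : ℝ) (1 - 1 / (2 * t)), ENNReal.ofReal (g w)
            ≤ ENNReal.ofReal (a + c * t) := by
          rcases lt_or_ge (1 / 2) t with h | h
          · exact hG t h
          · have : 1 ≤ 1 / (2 * t) := by
              rw [le_div_iff₀ (by positivity)]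
              linarith
            rw [Ioo_eq_empty (by linarith)]
            simp
        have hmem : ∀ w ∈ Ioo (0 : ℝ) 1, f w t = (Ioo (0 : ℝ) (1 - 1 / (2 * t))).indicator
            (fun w => ENNReal.ofReal (g w) * ENNReal.ofReal (t ^ (s - 1) * Real.exp (-t))) w := by
          intro w hw
          have hw1 : 0 < 1 - w := by linarith [hw.2]
          have key : 1 / (2 * (1 - w)) < t ↔ w < 1 - 1 / (2 * t) := by
            rw [lt_sub_comm, div_lt_iff₀ (by positivity), div_lt_iff₀ (by positivity)]
            constructor <;> intro h <;> linarith
          by_cases h : w < 1 - 1 / (2 * t)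
          · rw [indicator_of_mem (show w ∈ Ioo (0 : ℝ) (1 - 1 / (2 * t)) from ⟨hw.1, h⟩)]
            exact indicator_of_mem (show (w, t) ∈ S from key.2 h) _
          · rw [indicator_of_notMem (show w ∉ Ioo (0 : ℝ) (1 - 1 / (2 * t)) from fun h' => h h'.2)]
            exact indicator_of_notMem (show (w, t) ∉ S from fun h' => h (key.1 h')) _
        rw [setLIntegral_congr_fun measurableSet_Ioo hmem,
          setLIntegral_indicator measurableSet_Ioo, lintegral_mul_const _ hgm,
          ENNReal.ofReal_mul (mul_nonneg (Real.rpow_nonneg ht0.le _) (Real.exp_pos _).le), mul_comm]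
        exact mul_le_mul_right ((lintegral_mono_set inter_subset_left).trans hle) _
    _ = ENNReal.ofReal (Real.Gamma s * (a + c * s)) := by
        rw [← (integrableOn_and_integral_gamma_affine hs a c).2,
          ofReal_integral_eq_lintegral_ofReal (integrableOn_and_integral_gamma_affine hs a c).1]
        refine ae_restrict_of_forall_mem measurableSet_Ioi fun t ht => ?_
        have ht0 : 0 < t := ht
        simp only [Pi.zero_apply]
        positivity

/-- The fundamental theorem of calculus for lower integrals of nonnegative functions. -/
lemma lintegral_Ioo_eq_of_hasDerivAt {F g : ℝ → ℝ} {u v : ℝ} (huv : u ≤ v)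
    (hF : ContinuousOn F (Icc u v)) (hd : ∀ x ∈ Ioo u v, HasDerivAt F (g x) x)
    (hg : ∀ x ∈ Ioo u v, 0 ≤ g x) :
    ∫⁻ x in Ioo u v, ENNReal.ofReal (g x) = ENNReal.ofReal (F v - F u) := by
  have hi := intervalIntegral.integrableOn_deriv_of_nonneg hF hd hg
  have h := intervalIntegral.integral_eq_sub_of_hasDerivAt_of_le huv hF hd
    ((intervalIntegrable_iff_integrableOn_Ioc_of_le huv).2 hi)
  rw [← h, intervalIntegral.integral_of_le huv, integral_Ioc_eq_integral_Ioo,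
    ofReal_integral_eq_lintegral_ofReal (hi.mono_set Ioo_subset_Ioc_self)
      (ae_restrict_of_forall_mem measurableSet_Ioo hg)]

lemma rpow_neg_one_div_two {x : ℝ} (hx : 0 ≤ x) : x ^ (-(1 : ℝ) / 2) = (√x)⁻¹ := by
  rw [neg_div, Real.rpow_neg hx, Real.sqrt_eq_rpow]

lemma lintegral_rpow_mul_inv_le {u : ℝ} (hu : 0 ≤ u) (hu1 : u < 1) :
    ∫⁻ w in Ioo 0 u, ENNReal.ofReal (w ^ (-(1 : ℝ) / 2) * (1 - w) ^ (-(1 : ℝ)))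
      ≤ ENNReal.ofReal (Real.log (4 / (1 - u))) := by
  have hlt : ∀ x : ℝ, x < 1 → √x < 1 := fun x hx => by
    rw [Real.sqrt_lt' one_pos]
    simpa using hx
  rw [lintegral_Ioo_eq_of_hasDerivAt (F := fun w => Real.log (1 + √w) - Real.log (1 - √w)) hu]
  · apply ENNReal.ofReal_le_ofReal
    have h1 := hlt u hu1
    have h0 := Real.sqrt_nonneg u
    simp only [Real.sqrt_zero, add_zero, sub_zero, Real.log_one]
    rw [← Real.log_div (by linarith) (by linarith)]
    apply Real.log_le_log (div_pos (by linarith) (by linarith))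
    rw [div_le_div_iff₀ (by linarith) (by linarith)]
    have hs := Real.sq_sqrt hu
    have : 1 - u = (1 - √u) * (1 + √u) := by linear_combination hs
    rw [this]
    nlinarith [mul_nonneg (sub_nonneg.2 h1.le) (by nlinarith : 0 ≤ 4 - (1 + √u) ^ 2)]
  · refine ContinuousOn.sub (ContinuousOn.log (by fun_prop) fun x _ => ?_)
      (ContinuousOn.log (by fun_prop) fun x hx => ?_)
    · have := Real.sqrt_nonneg x
      linarith
    · have := hlt x (hx.2.trans_lt hu1)
      linarith
  · intro x hx
    have hx1 : x < 1 := hx.2.trans hu1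
    have h1 := hlt x hx1
    have h0 := Real.sqrt_pos.2 hx.1
    have hd := (hasDerivAt_id x).sqrt hx.1.ne'
    refine (((hd.const_add 1).log (by simp; linarith)).sub
      ((hd.const_sub 1).log (by simp; linarith))).congr_deriv ?_
    simp only [id]
    rw [rpow_neg_one_div_two hx.1.le, Real.rpow_neg_one]
    have hs := Real.sq_sqrt hx.1.le
    have e : 1 - x = (1 - √x) * (1 + √x) := by linear_combination hs
    have h2 : 1 - √x ≠ 0 := by linarith
    have h3 : 1 + √x ≠ 0 := by linarith
    rw [e]
    field_simp
    ring
  · intro x hx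
    have := hx.1
    have : 0 < 1 - x := by linarith [hx.2]
    positivity

lemma lintegral_rpow_mul_rpow_eq {u : ℝ} (hu : 0 ≤ u) (hu1 : u < 1) :
    ∫⁻ w in Ioo 0 u, ENNReal.ofReal (w ^ (-(1 : ℝ) / 2) * (1 - w) ^ (-(3 : ℝ) / 2))
      = ENNReal.ofReal (2 * √u / √(1 - u)) := by
  rw [lintegral_Ioo_eq_of_hasDerivAt (F := fun w => 2 * √w / √(1 - w)) hu]
  · simp
  · refine ContinuousOn.div (by fun_prop) (by fun_prop) fun x hx => ?_
    have : 0 < 1 - x := by linarith [hx.2]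
    positivity
  · intro x hx
    have hx1 : 0 < 1 - x := by linarith [hx.2]
    have h0 := Real.sqrt_pos.2 hx.1
    have h1 := Real.sqrt_pos.2 hx1
    refine ((((hasDerivAt_id x).sqrt hx.1.ne').const_mul 2).div
      (((hasDerivAt_id x).const_sub 1).sqrt hx1.ne') h1.ne').congr_deriv ?_
    simp only [id]
    have e : (1 - x) ^ (-(3 : ℝ) / 2) = ((1 - x) * √(1 - x))⁻¹ := by
      rw [mul_inv, ← rpow_neg_one_div_two hx1.le, ← Real.rpow_neg_one, ← Real.rpow_add hx1]
      norm_num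
    rw [rpow_neg_one_div_two hx.1.le, e]
    have hs := Real.sq_sqrt hx.1.le
    have hs1 := Real.sq_sqrt hx1.le
    field_simp
    rw [hs, hs1]
    ring
  · intro x hx
    have := hx.1
    have : 0 < 1 - x := by linarith [hx.2]
    positivity

lemma integral_rpow_mul_inv_mul_uGamma_le {n : ℝ} (hn : 1 ≤ n) :
    ∫ w in Ioo (0 : ℝ) 1, w ^ (-(1 : ℝ) / 2) * (1 - w) ^ (-(1 : ℝ)) * uGamma (n / 2)
      (1 / (2 * (1 - w))) ≤ Real.Gamma (n / 2) * Real.log (4 * n) := by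
  have h4 : 1 ≤ Real.log (4 * n) := by
    rw [Real.le_log_iff_exp_le (by linarith)]
    linarith [Real.exp_one_lt_d9]
  have h := integral_mul_uGamma_le (g := fun w => w ^ (-(1 : ℝ) / 2) * (1 - w) ^ (-(1 : ℝ)))
    (s := n / 2) (a := Real.log (4 * n) - 1) (c := 2 / n) (by fun_prop)
    (fun w hw => mul_nonneg (Real.rpow_nonneg hw.1.le _)
      (Real.rpow_nonneg (by linarith [hw.2]) _))
    (by linarith) (by linarith) (by positivity) ?_
  · convert h using 2
    field_simp
    ring
  · intro t ht
    have h1 : 1 / (2 * t) < 1 := by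
      rw [div_lt_iff₀ (by linarith)]
      linarith
    have h2 : 0 < 1 / (2 * t) := by simp; linarith
    refine (lintegral_rpow_mul_inv_le (by linarith) (by linarith)).trans
      (ENNReal.ofReal_le_ofReal ?_)
    have ht0 : 0 < t := by linarith
    have e : 4 / (1 - (1 - 1 / (2 * t))) = 4 * n * (2 * t / n) := by
      field_simp
      ring
    rw [e, Real.log_mul (by positivity) (by positivity)]
    have := Real.log_le_sub_one_of_pos (x := 2 * t / n) (by positivity)
    have e2 : 2 * t / n = 2 / n * t := by ring
    linarith

lemma integral_rpow_mul_rpow_mul_uGamma_le {n : ℝ} (hn : 2 ≤ n) :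
    ∫ w in Ioo (0 : ℝ) 1, w ^ (-(1 : ℝ) / 2) * (1 - w) ^ (-(3 : ℝ) / 2) * uGamma (n / 2)
      (1 / (2 * (1 - w))) ≤ Real.Gamma (n / 2) * (2 * √(n - 1)) := by
  have hq : 0 < √(n - 1) := Real.sqrt_pos.2 (by linarith)
  have hq2 := Real.sq_sqrt (show 0 ≤ n - 1 by linarith)
  have h := integral_mul_uGamma_le (g := fun w => w ^ (-(1 : ℝ) / 2) * (1 - w) ^ (-(3 : ℝ) / 2))
    (s := n / 2) (a := (n - 2) / √(n - 1)) (c := 2 / √(n - 1)) (by fun_prop)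
    (fun w hw => mul_nonneg (Real.rpow_nonneg hw.1.le _)
      (Real.rpow_nonneg (by linarith [hw.2]) _))
    (by linarith) (div_nonneg (by linarith) hq.le) (by positivity) ?_
  · convert h using 2
    field_simp
    linarith
  · intro t ht
    have ht0 : 0 < t := by linarith
    have h1 : 1 / (2 * t) < 1 := by
      rw [div_lt_iff₀ (by linarith)]
      linarith
    have h2 : 0 < 1 / (2 * t) := by simp; linarith
    rw [lintegral_rpow_mul_rpow_eq (by linarith) (by linarith)]
    apply ENNReal.ofReal_le_ofReal
    have e : 2 * √(1 - 1 / (2 * t)) / √(1 - (1 - 1 / (2 * t))) = 2 * √(2 * t - 1) := by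
      rw [mul_div_assoc, ← Real.sqrt_div (by linarith)]
      congr 2
      field_simp
      ring
    have hr := Real.sq_sqrt (show 0 ≤ 2 * t - 1 by linarith)
    have e2 : (n - 2) / √(n - 1) + 2 / √(n - 1) * t = (n - 2 + 2 * t) / √(n - 1) := by ring
    rw [e, e2, le_div_iff₀ hq]
    nlinarith [sq_nonneg (√(2 * t - 1) - √(n - 1))]

lemma log_four_mul_le {n : ℝ} (hn : 3 ≤ n) : Real.log (4 * n) ≤ n / 2 + 1 := by
  have h12 : Real.log 12 ≤ 5 / 2 := by
    rw [Real.log_le_iff_le_exp (by norm_num)]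
    have h := Real.exp_one_gt_d9
    have e : Real.exp (5 / 2) ^ 2 = Real.exp 1 ^ 5 := by
      rw [← Real.exp_nat_mul, ← Real.exp_nat_mul]
      norm_num
    have h5 : (2.7182818283 : ℝ) ^ 5 ≤ Real.exp 1 ^ 5 := by gcongr
    refine le_of_sq_le_sq ?_ (Real.exp_pos _).le
    rw [e]
    refine le_trans ?_ h5
    norm_num
  have e : 4 * n = 12 * (n / 3) := by ring
  rw [e, Real.log_mul (by norm_num) (by positivity)]
  have := Real.log_le_sub_one_of_pos (x := n / 3) (by positivity)
  linarith

/-- For `k ∈ {1,2}` and `n ≥ max(2, 4-k)`: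
`∫₀¹ w^(-1/2)(1-w)^(-(k+1)/2) Γ(n/2, 1/(2(1-w))) dw
  ≤ Γ(n/2) ∫₀¹ w^(-1/2)(1-w)^(-1 + 2 n^(-(k+1)/2)) dw = Γ(n/2) B(1/2, 2 n^(-(k+1)/2))`. -/
theorem stmt_5 (k : ℕ) (hk : k = 1 ∨ k = 2) (n : ℕ) (hn : max 2 (4 - k) ≤ n) :
    (∫ w in Set.Ioo (0 : ℝ) 1,
        w ^ (-(1:ℝ)/2) * (1 - w) ^ (-((k : ℝ) + 1)/2)
          * uGamma ((n : ℝ)/2) (1/(2*(1 - w))))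
      ≤ Real.Gamma ((n : ℝ)/2) *
        ∫ w in Set.Ioo (0 : ℝ) 1,
          w ^ (-(1:ℝ)/2) * (1 - w) ^ (-1 + 2 * (n : ℝ) ^ (-((k : ℝ) + 1)/2)) ∧
    Real.Gamma ((n : ℝ)/2) *
        (∫ w in Set.Ioo (0 : ℝ) 1,
          w ^ (-(1:ℝ)/2) * (1 - w) ^ (-1 + 2 * (n : ℝ) ^ (-((k : ℝ) + 1)/2)))
      = Real.Gamma ((n : ℝ)/2) * Beta (1/2) (2 * (n : ℝ) ^ (-((k : ℝ) + 1)/2)) := by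
  have hn2 : 2 ≤ n := (le_max_left _ _).trans hn
  have hn2' : (2 : ℝ) ≤ n := by exact_mod_cast hn2
  have hn0 : (0 : ℝ) < n := by linarith
  set b : ℝ := 2 * (n : ℝ) ^ (-((k : ℝ) + 1) / 2) with hb
  have hb0 : 0 < b := by positivity
  have e1 : -(1 : ℝ) / 2 = 1 / 2 - 1 := by norm_num
  have e2 : -1 + b = b - 1 := by ring
  have hG := Real.Gamma_pos_of_pos (show 0 < (n : ℝ) / 2 by positivity)
  constructor
  swap
  · rw [e1, e2, (integrableOn_beta_and_integral_eq (by norm_num) hb0).2]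
  · rcases hk with rfl | rfl
    · have hn3 : (3 : ℝ) ≤ n := by exact_mod_cast (le_max_right _ _).trans hn
      have ek : -(((1 : ℕ) : ℝ) + 1) / 2 = -1 := by norm_num
      rw [ek] at hb ⊢
      rw [Real.rpow_neg_one] at hb
      have hb1 : b ≤ 1 := by
        rw [hb, ← div_eq_mul_inv, div_le_one hn0]
        linarith
      refine (integral_rpow_mul_inv_mul_uGamma_le (by linarith)).trans ?_
      rw [e1, e2]
      refine mul_le_mul_of_nonneg_left ?_ hG.le
      refine (log_four_mul_le hn3).trans (le_trans (le_of_eq ?_)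
        (one_div_add_one_le_integral_beta hb0 hb1))
      rw [hb]
      field_simp
    · have ek : -(((2 : ℕ) : ℝ) + 1) / 2 = -3 / 2 := by norm_num
      rw [ek] at hb ⊢
      have hy := Real.sq_sqrt hn0.le
      have hy0 := Real.sqrt_pos.2 hn0
      have e : (n : ℝ) ^ (-(3 : ℝ) / 2) = (n * √n)⁻¹ := by
        rw [mul_inv, ← rpow_neg_one_div_two hn0.le, ← Real.rpow_neg_one, ← Real.rpow_add hn0]
        norm_num
      rw [e] at hb
      have hy1 : 1 ≤ √(n : ℝ) := Real.one_le_sqrt.2 (by linarith)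
      have hb1 : b ≤ 1 := by
        rw [hb, ← div_eq_mul_inv, div_le_one (by positivity)]
        nlinarith
      refine (integral_rpow_mul_rpow_mul_uGamma_le hn2').trans ?_
      rw [e1, e2]
      refine mul_le_mul_of_nonneg_left ?_ hG.le
      refine le_trans ?_ (one_div_add_one_le_integral_beta hb0 hb1)
      have eb : 1 / b = n * √n / 2 := by
        rw [hb]
        field_simp
      rw [eb]
      have hq : 2 * √((n : ℝ) - 1) ≤ n := by
        nlinarith [Real.sq_sqrt (show 0 ≤ (n : ℝ) - 1 by linarith),
          sq_nonneg (√((n : ℝ) - 1) - 1)]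
      refine hq.trans ?_
      rw [← hy, Real.sqrt_sq hy0.le]
      nlinarith [mul_nonneg hy0.le (sq_nonneg (√(n : ℝ) - 4 / 3)), sq_nonneg (√(n : ℝ) - 4 / 3)]
end

section
/- Let m ≥ 4 be an integer and set b = m/2. Then ∫_0^∞ e^{−t/2} · t^{−1/2} · (1+t)^{b − 3/2} dt ≤ 2^b · Γ(b − 1/2). -/
open MeasureTheory Set

/-- The integrand `e^(-t/2) t^(-1/2) (1+t)^p` of the Kummer integral at `a = z = 1/2`. -/
noncomputable def kummerIntegrand (p t : ℝ) : ℝ :=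
  Real.exp (-t/2) * t ^ (-(1:ℝ)/2) * (1 + t) ^ p

lemma integrableOn_exp_neg_half_mul_rpow {s : ℝ} (hs : -1 < s) :
    IntegrableOn (fun t : ℝ => Real.exp (-t/2) * t ^ s) (Ioi 0) := by
  refine (integrableOn_rpow_mul_exp_neg_mul_rpow hs one_pos
    (by norm_num : (0:ℝ) < 1/2)).congr_fun (fun t _ => ?_) measurableSet_Ioi
  simp only [Real.rpow_one]
  rw [mul_comm]
  congr 2
  ring

lemma one_add_rpow_le {t : ℝ} (ht : 0 < t) (p : ℝ) :
    (1 + t) ^ p ≤ 2 ^ |p| * (1 + t ^ |p|) := by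
  have h0 : 0 ≤ t ^ |p| := by positivity
  refine (Real.rpow_le_rpow_of_exponent_le (by linarith) (le_abs_self p)).trans ?_
  rcases le_total t 1 with h | h
  · calc (1 + t) ^ |p| ≤ 2 ^ |p| :=
          Real.rpow_le_rpow (by linarith) (by linarith) (abs_nonneg p)
      _ ≤ 2 ^ |p| * (1 + t ^ |p|) := le_mul_of_one_le_right (by positivity) (by linarith)
  · calc (1 + t) ^ |p| ≤ (2 * t) ^ |p| :=
          Real.rpow_le_rpow (by linarith) (by linarith) (abs_nonneg p)
      _ = 2 ^ |p| * t ^ |p| := Real.mul_rpow (by norm_num) ht.le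
      _ ≤ 2 ^ |p| * (1 + t ^ |p|) := by gcongr; linarith

lemma integrableOn_kummerIntegrand (p : ℝ) : IntegrableOn (kummerIntegrand p) (Ioi 0) := by
  have hdom := ((integrableOn_exp_neg_half_mul_rpow (s := -(1:ℝ)/2) (by norm_num)).add
    (integrableOn_exp_neg_half_mul_rpow (s := -(1:ℝ)/2 + |p|)
      (by have := abs_nonneg p; linarith))).const_mul (2 ^ |p|)
  refine Integrable.mono' hdom ?_ ?_
  · unfold kummerIntegrand
    exact Measurable.aestronglyMeasurable (by fun_prop)
  · refine (ae_restrict_iff' measurableSet_Ioi).2 (Filter.Eventually.of_forall fun t ht => ?_)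
    have ht' : 0 < t := ht
    have hb := mul_le_mul_of_nonneg_left (one_add_rpow_le ht' p)
      (by positivity : 0 ≤ Real.exp (-t/2) * t ^ (-(1:ℝ)/2))
    rw [kummerIntegrand, Real.norm_of_nonneg (by positivity)]
    refine hb.trans_eq ?_
    simp only [Pi.add_apply, Real.rpow_add ht']
    ring

lemma kummerIntegrand_nonneg (p : ℝ) {t : ℝ} (ht : 0 < t) : 0 ≤ kummerIntegrand p t := by
  unfold kummerIntegrand
  positivity

lemma kummerIntegrand_add_one (p : ℝ) {t : ℝ} (ht : 0 < t) :
    kummerIntegrand (p + 1) t = (1 + t) * kummerIntegrand p t := by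
  rw [kummerIntegrand, kummerIntegrand, Real.rpow_add_one (by positivity)]
  ring

lemma kummerIntegrand_primitive_eq (p : ℝ) {t : ℝ} (ht : 0 < t) :
    Real.exp (-t/2) * t ^ ((1:ℝ)/2) * (1 + t) ^ p
      = kummerIntegrand (p + 1) t - kummerIntegrand p t := by
  have h : t ^ ((1:ℝ)/2) = t ^ (-(1:ℝ)/2) * t := by
    rw [← Real.rpow_add_one ht.ne']; norm_num
  rw [kummerIntegrand_add_one p ht, h, kummerIntegrand]
  ring

lemma hasDerivAt_kummerIntegrand_primitive (p : ℝ) {t : ℝ} (ht : 0 < t) :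
    HasDerivAt (fun t : ℝ => Real.exp (-t/2) * t ^ ((1:ℝ)/2) * (1 + t) ^ p)
      ((p + 1) * kummerIntegrand p t - 1/2 * kummerIntegrand (p + 1) t
        - p * kummerIntegrand (p - 1) t) t := by
  have h1 : HasDerivAt (fun t : ℝ => Real.exp (-t/2)) (Real.exp (-t/2) * (-1/2)) t :=
    ((hasDerivAt_id t).neg.div_const 2).exp
  have h2 : HasDerivAt (fun t : ℝ => t ^ ((1:ℝ)/2)) (1/2 * t ^ ((1:ℝ)/2 - 1)) t :=
    Real.hasDerivAt_rpow_const (Or.inl ht.ne')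
  have h3 : HasDerivAt (fun t : ℝ => (1 + t) ^ p) (1 * p * (1 + t) ^ (p - 1)) t :=
    ((hasDerivAt_id t).const_add 1).rpow_const (Or.inl (by simp only [id]; positivity))
  refine ((h1.mul h2).mul h3).congr_deriv ?_
  have ha : t ^ ((1:ℝ)/2) = t ^ (-(1:ℝ)/2) * t := by
    rw [← Real.rpow_add_one ht.ne']; norm_num
  have hb : (1:ℝ)/2 - 1 = -(1:ℝ)/2 := by norm_num
  have hc : kummerIntegrand p t = (1 + t) * kummerIntegrand (p - 1) t := by
    rw [← kummerIntegrand_add_one _ ht, sub_add_cancel]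
  have hd : (1 + t) ^ p = (1 + t) ^ (p - 1) * (1 + t) := by
    rw [← Real.rpow_add_one (by positivity), sub_add_cancel]
  rw [kummerIntegrand_add_one p ht, hc, kummerIntegrand]
  simp only [Pi.mul_apply]
  rw [hb, ha, hd]
  ring

/-- The three-term recurrence of the Kummer integrals, by integration by parts. -/
lemma integral_kummerIntegrand_add_one (p : ℝ) :
    ∫ t in Ioi 0, kummerIntegrand (p + 1) t
      = 2 * (p + 1) * (∫ t in Ioi 0, kummerIntegrand p t)
        - 2 * p * ∫ t in Ioi 0, kummerIntegrand (p - 1) t := by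
  have i0 := (integrableOn_kummerIntegrand p).const_mul (p + 1)
  have i1 := (integrableOn_kummerIntegrand (p + 1)).const_mul (1/2)
  have i2 := (integrableOn_kummerIntegrand (p - 1)).const_mul p
  have hF : IntegrableOn (fun t : ℝ => Real.exp (-t/2) * t ^ ((1:ℝ)/2) * (1 + t) ^ p) (Ioi 0) :=
    ((integrableOn_kummerIntegrand (p + 1)).sub (integrableOn_kummerIntegrand p)).congr_fun
      (fun t ht => (kummerIntegrand_primitive_eq p ht).symm) measurableSet_Ioi
  have hcont : ContinuousWithinAt
      (fun t : ℝ => Real.exp (-t/2) * t ^ ((1:ℝ)/2) * (1 + t) ^ p) (Ici 0) 0 := by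
    refine ContinuousAt.continuousWithinAt ?_
    refine ContinuousAt.mul (ContinuousAt.mul (by fun_prop) ?_) ?_
    · exact Real.continuousAt_rpow_const _ _ (Or.inr (by norm_num))
    · exact ContinuousAt.rpow_const (by fun_prop) (Or.inl (by norm_num))
  have hlim := tendsto_zero_of_hasDerivAt_of_integrableOn_Ioi
    (fun t ht => hasDerivAt_kummerIntegrand_primitive p ht) ((i0.sub i1).sub i2) hF
  have key := integral_Ioi_of_hasDerivAt_of_tendsto hcont
    (fun t ht => hasDerivAt_kummerIntegrand_primitive p ht) ((i0.sub i1).sub i2) hlim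
  rw [integral_sub (by exact i0.sub i1) i2, integral_sub i0 i1] at key
  simp only [integral_const_mul] at key
  norm_num at key
  linarith

lemma integral_kummerIntegrand_zero :
    ∫ t in Ioi 0, kummerIntegrand 0 t = √2 * √Real.pi := by
  have h := Real.integral_rpow_mul_exp_neg_mul_Ioi (a := 1/2) (r := 1/2)
    (by norm_num) (by norm_num)
  rw [Real.Gamma_one_half_eq, one_div_one_div, ← Real.sqrt_eq_rpow] at h
  rw [← h]
  refine setIntegral_congr_fun measurableSet_Ioi fun t _ => ?_
  simp only [kummerIntegrand, Real.rpow_zero, mul_one]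
  rw [mul_comm]
  congr 2 <;> ring

lemma integral_kummerIntegrand_half_le :
    ∫ t in Ioi 0, kummerIntegrand (1/2) t ≤ 2 * √Real.pi := by
  have h1 := integral_kummerIntegrand_add_one 0
  rw [integral_kummerIntegrand_zero] at h1
  have i0 := (integrableOn_kummerIntegrand 0).const_mul (√2 / 2)
  have i1 := (integrableOn_kummerIntegrand (0 + 1)).const_mul (√2 / 4)
  have h2 : (√2) ^ 2 = 2 := Real.sq_sqrt (by norm_num)
  have hle : ∫ t in Ioi 0, kummerIntegrand (1/2) t
      ≤ ∫ t in Ioi 0, (√2 / 2 * kummerIntegrand 0 t + √2 / 4 * kummerIntegrand (0 + 1) t) := by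
    refine setIntegral_mono_on (integrableOn_kummerIntegrand _) (i0.add i1) measurableSet_Ioi
      fun t ht => ?_
    have ht' : 0 < t := ht
    rw [kummerIntegrand_add_one 0 ht', kummerIntegrand, kummerIntegrand, Real.rpow_zero,
      ← Real.sqrt_eq_rpow]
    have hs : √(1 + t) ≤ √2 / 2 + √2 / 4 * (1 + t) := by
      refine Real.sqrt_le_iff.2 ⟨by positivity, ?_⟩
      have : (√2 / 2 + √2 / 4 * (1 + t)) ^ 2 = (√2) ^ 2 * (3 + t) ^ 2 / 16 := by ring
      rw [this, h2]
      nlinarith [sq_nonneg (t - 1)]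
    have := mul_le_mul_of_nonneg_left hs
      (by positivity : 0 ≤ Real.exp (-t/2) * t ^ (-(1:ℝ)/2))
    linarith
  rw [integral_add i0 i1, integral_const_mul, integral_const_mul,
    integral_kummerIntegrand_zero, h1] at hle
  refine hle.trans_eq ?_
  linear_combination √Real.pi * h2

lemma integral_kummerIntegrand_le_add_one {p : ℝ} (hp : 0 ≤ p)
    (h : ∫ t in Ioi 0, kummerIntegrand p t ≤ 2 ^ (p + 3/2) * Real.Gamma (p + 1)) :
    ∫ t in Ioi 0, kummerIntegrand (p + 1) t
      ≤ 2 ^ (p + 1 + 3/2) * Real.Gamma (p + 1 + 1) := by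
  have h0 : 0 ≤ ∫ t in Ioi 0, kummerIntegrand (p - 1) t :=
    setIntegral_nonneg measurableSet_Ioi fun t ht => kummerIntegrand_nonneg _ ht
  rw [integral_kummerIntegrand_add_one, Real.Gamma_add_one (s := p + 1) (by positivity),
    show p + 1 + 3/2 = p + 3/2 + 1 by ring, Real.rpow_add_one (by norm_num)]
  have := mul_le_mul_of_nonneg_left h (by positivity : 0 ≤ 2 * (p + 1))
  have := mul_nonneg (by positivity : 0 ≤ 2 * p) h0
  linarith

lemma integral_kummerIntegrand_le (n : ℕ) :
    ∫ t in Ioi 0, kummerIntegrand ((n : ℝ) / 2) t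
      ≤ 2 ^ ((n : ℝ) / 2 + 3/2) * Real.Gamma ((n : ℝ) / 2 + 1) := by
  induction n using Nat.twoStepInduction with
  | zero =>
    have hpi : √Real.pi ≤ 2 := Real.sqrt_le_iff.2 ⟨by norm_num, by linarith [Real.pi_le_four]⟩
    have h32 : (2:ℝ) ^ ((3:ℝ)/2) = √2 * 2 := by
      rw [Real.sqrt_eq_rpow, ← Real.rpow_add_one (by norm_num)]; norm_num
    simp only [Nat.cast_zero, zero_div, zero_add, Real.Gamma_one, mul_one,
      integral_kummerIntegrand_zero, h32]
    gcongr
  | one =>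
    rw [Nat.cast_one, Real.Gamma_add_one (by norm_num), Real.Gamma_one_half_eq,
      show (1:ℝ)/2 + 3/2 = (2:ℕ) by norm_num, Real.rpow_natCast]
    exact integral_kummerIntegrand_half_le.trans_eq (by ring)
  | more n ih _ =>
    have := integral_kummerIntegrand_le_add_one (by positivity) ih
    rwa [show (n : ℝ) / 2 + 1 = ((n + 2 : ℕ) : ℝ) / 2 by push_cast; ring] at this

/-- Bound on the confluent hypergeometric function of the second kind at
`a = 1/2`, `z = 1/2`: for `b = m/2` with `m ≥ 4`,
`∫₀^∞ e^(-t/2) t^(-1/2) (1+t)^(b-3/2) dt ≤ 2^b Γ(b - 1/2)`. -/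
theorem stmt_6 (m : ℕ) (hm : 4 ≤ m) :
    (∫ t in Set.Ioi (0 : ℝ),
        Real.exp (-t/2) * t ^ (-(1:ℝ)/2) * (1 + t) ^ ((m : ℝ)/2 - 3/2))
      ≤ (2 : ℝ) ^ ((m : ℝ)/2) * Real.Gamma ((m : ℝ)/2 - 1/2) := by
  obtain ⟨n, rfl⟩ := Nat.exists_eq_add_of_le (show 3 ≤ m by lia)
  have h := integral_kummerIntegrand_le n
  simp only [kummerIntegrand] at h
  convert h using 4 <;> push_cast <;> ring_nf
end

section
/- The function z ↦ e^z · ∫_0^∞ e^{−z·cosh(t)} dt is strictly decreasing on (0, ∞); that is, for all real 0 < z₁ < z₂, e^{z₂} ∫_0^∞ e^{−z₂ cosh t} dt < e^{z₁} ∫_0^∞ e^{−z₁ cosh t} dt. -/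
open MeasureTheory Set

lemma integrableOn_exp_neg_mul_cosh {z : ℝ} (hz : 0 < z) :
    IntegrableOn (fun t ↦ Real.exp (-(z * Real.cosh t))) (Ioi 0) := by
  refine (exp_neg_integrableOn_Ioi 0 hz).mono' (by fun_prop) ?_
  filter_upwards [ae_restrict_mem measurableSet_Ioi] with t ht
  rw [Real.norm_of_nonneg (Real.exp_pos _).le, neg_mul]
  have : t ≤ Real.cosh t := (Real.self_le_sinh_iff.2 (mem_Ioi.1 ht).le).trans
    (Real.sinh_lt_cosh t).le
  gcongr

/-- `e^z K₀(z)` is strictly decreasing on `(0, ∞)`, where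
`K₀(z) = ∫₀^∞ e^(-z cosh t) dt` is the modified Bessel function of the
second kind of order zero. -/
theorem stmt_7 (z₁ z₂ : ℝ) (h₁ : 0 < z₁) (h₂ : z₁ < z₂) :
    Real.exp z₂ * ∫ t in Set.Ioi (0 : ℝ), Real.exp (-(z₂ * Real.cosh t))
      < Real.exp z₁ * ∫ t in Set.Ioi (0 : ℝ), Real.exp (-(z₁ * Real.cosh t)) := by
  have hi₁ := (integrableOn_exp_neg_mul_cosh h₁).const_mul (Real.exp z₁)
  have hi₂ := (integrableOn_exp_neg_mul_cosh (h₁.trans h₂)).const_mul (Real.exp z₂)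
  have hlt : ∀ t ∈ Ioi (0 : ℝ), 0 < Real.exp z₁ * Real.exp (-(z₁ * Real.cosh t))
      - Real.exp z₂ * Real.exp (-(z₂ * Real.cosh t)) := fun t ht ↦ by
    rw [sub_pos, ← Real.exp_add, ← Real.exp_add, Real.exp_lt_exp]
    nlinarith [Real.one_lt_cosh.2 (mem_Ioi.1 ht).ne']
  rw [← integral_const_mul, ← integral_const_mul, ← sub_pos, ← integral_sub hi₁ hi₂,
    setIntegral_pos_iff_support_of_nonneg_ae
      ((ae_restrict_mem measurableSet_Ioi).mono fun t ht ↦ (hlt t ht).le) (hi₁.sub hi₂),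
    inter_eq_right.2 fun t ht ↦ Function.mem_support.2 (hlt t ht).ne', Real.volume_Ioi]
  exact ENNReal.zero_lt_top
end

section
/- The function z ↦ e^z · ∫_0^∞ e^{−z·cosh(t)} · cosh(t) dt is strictly decreasing on (0, ∞); that is, for all real 0 < z₁ < z₂, e^{z₂} ∫_0^∞ e^{−z₂ cosh t} cosh t dt < e^{z₁} ∫_0^∞ e^{−z₁ cosh t} cosh t dt. -/
open MeasureTheory Set

/-- The integrand of `K₁(z)` is integrable on `(0, ∞)`. -/
theorem integrableOn_exp_neg_mul_cosh_mul_cosh {z : ℝ} (hz : 0 < z) :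
    IntegrableOn (fun t : ℝ => Real.exp (-(z * Real.cosh t)) * Real.cosh t) (Ioi 0) := by
  refine ((exp_neg_integrableOn_Ioi 0 one_pos).const_mul (4 / z ^ 2)).mono'
    (by fun_prop) (.of_forall fun t => ?_)
  have hc : 0 < Real.cosh t := Real.cosh_pos t
  have hquad : (z * Real.cosh t) ^ 2 / 2 ≤ Real.exp (z * Real.cosh t) := by
    have := Real.quadratic_le_exp_of_nonneg (x := z * Real.cosh t) (by positivity)
    nlinarith [mul_pos hz hc]
  have hexp : Real.exp t ≤ 2 * Real.cosh t := by
    rw [Real.cosh_eq]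
    linarith [Real.exp_pos (-t)]
  rw [Real.norm_of_nonneg (by positivity), neg_one_mul, Real.exp_neg, Real.exp_neg]
  calc (Real.exp (z * Real.cosh t))⁻¹ * Real.cosh t
      ≤ ((z * Real.cosh t) ^ 2 / 2)⁻¹ * Real.cosh t := by gcongr
    _ = 4 / z ^ 2 * (2 * Real.cosh t)⁻¹ := by field_simp; norm_num
    _ ≤ 4 / z ^ 2 * (Real.exp t)⁻¹ := by gcongr

/-- A function dominating another strictly on a set of positive measure has strictly larger
integral there. -/
theorem setIntegral_lt_setIntegral_of_forall_lt {α : Type*} [MeasurableSpace α] {μ : Measure α}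
    {s : Set α} {f g : α → ℝ} (hs : MeasurableSet s) (hμ : 0 < μ s) (hf : IntegrableOn f s μ)
    (hg : IntegrableOn g s μ) (h : ∀ x ∈ s, f x < g x) :
    ∫ x in s, f x ∂μ < ∫ x in s, g x ∂μ := by
  rw [← sub_pos, ← integral_sub hg hf, setIntegral_pos_iff_support_of_nonneg_ae
    ((ae_restrict_iff' hs).2 (.of_forall fun x hx => (sub_pos.2 (h x hx)).le)) (hg.sub hf)]
  exact hμ.trans_le (measure_mono fun x hx => ⟨(sub_pos.2 (h x hx)).ne', hx⟩)

/-- `e^z K₁(z)` is strictly decreasing on `(0, ∞)`, where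
`K₁(z) = ∫₀^∞ e^(-z cosh t) cosh t dt` is the modified Bessel function of the
second kind of order one. -/
theorem stmt_8 (z₁ z₂ : ℝ) (h₁ : 0 < z₁) (h₂ : z₁ < z₂) :
    Real.exp z₂ * ∫ t in Set.Ioi (0 : ℝ), Real.exp (-(z₂ * Real.cosh t)) * Real.cosh t
      < Real.exp z₁ * ∫ t in Set.Ioi (0 : ℝ), Real.exp (-(z₁ * Real.cosh t)) * Real.cosh t := by
  rw [← integral_const_mul, ← integral_const_mul]
  refine setIntegral_lt_setIntegral_of_forall_lt measurableSet_Ioi (by simp)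
    ((integrableOn_exp_neg_mul_cosh_mul_cosh (h₁.trans h₂)).const_mul _)
    ((integrableOn_exp_neg_mul_cosh_mul_cosh h₁).const_mul _) fun t ht => ?_
  have hc : 1 < Real.cosh t := Real.one_lt_cosh.2 (ne_of_gt ht)
  rw [← mul_assoc, ← mul_assoc, ← Real.exp_add, ← Real.exp_add]
  gcongr ?_ * _
  exact Real.exp_lt_exp.2 (by nlinarith)
end

section
/- Let k > 1 be a real number, let a < μ be real numbers, and let B ∈ (0, 1/2). Then ∫_{y=a}^{μ} ∫_{z = y + 2(μ−y)B}^{μ} (2(μ − y))^k / ((k+1)(z − y)^k) dz dy = ((μ − a)²/(k² − 1)) · (B^{1−k} − 2^{k−1}). -/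
open MeasureTheory Set intervalIntegral

/-- The inner integral, in the variable `u = z - y` and with `t = μ - y`. -/
theorem integral_mul_rpow_div_rpow {k t B : ℝ} (hk : 1 < k) (ht : 0 < t) (hB : 0 < B) :
    (∫ u in (2 * t * B)..t, (2 * t) ^ k / ((k + 1) * u ^ k))
      = 2 / (k ^ 2 - 1) * (B ^ (1 - k) - 2 ^ (k - 1)) * t := by
  have hpos : 0 < 2 * t * B := by positivity
  have hcongr : (∫ u in (2 * t * B)..t, (2 * t) ^ k / ((k + 1) * u ^ k))
      = ∫ u in (2 * t * B)..t, (2 * t) ^ k / (k + 1) * u ^ (-k) := by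
    refine intervalIntegral.integral_congr fun u hu => ?_
    have hu0 : 0 < u := (lt_min hpos ht).trans_le hu.1
    simp only [Real.rpow_neg hu0.le, div_eq_mul_inv, mul_inv, mul_assoc]
  have h0 : (0 : ℝ) ∉ uIcc (2 * t * B) t := notMem_uIcc_of_lt hpos ht
  rw [hcongr, intervalIntegral.integral_const_mul, integral_rpow (Or.inr ⟨by linarith, h0⟩),
    show -k + 1 = 1 - k by ring, Real.mul_rpow (by positivity) hB.le,
    Real.mul_rpow two_pos.le ht.le, Real.mul_rpow two_pos.le ht.le,
    Real.rpow_sub two_pos, Real.rpow_sub ht, Real.rpow_sub two_pos,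
    Real.rpow_one, Real.rpow_one]
  have h1 : k - 1 ≠ 0 := by linarith
  have h2 : 1 - k ≠ 0 := by linarith
  have h3 : k + 1 ≠ 0 := by linarith
  have h4 : k ^ 2 - 1 ≠ 0 := by
    rw [show k ^ 2 - 1 = (k - 1) * (k + 1) by ring]
    exact mul_ne_zero h1 h3
  have h5 : (2 : ℝ) ^ k ≠ 0 := (Real.rpow_pos_of_pos two_pos k).ne'
  have h6 : t ^ k ≠ 0 := (Real.rpow_pos_of_pos ht k).ne'
  field_simp
  ring

/-- Exact evaluation of the double integral in the regret lower bound for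
Thompson sampling with prior `σ^(-k)`, `k > 1`, in the two-armed uniform
bandit: for `a < μ` and `B ∈ (0, 1/2)`,
`∫_a^μ ∫_{y+2(μ-y)B}^μ (2(μ-y))^k/((k+1)(z-y)^k) dz dy
  = ((μ-a)²/(k²-1)) (B^(1-k) - 2^(k-1))`. -/
theorem stmt_11 (k a μ B : ℝ) (hk : 1 < k) (haμ : a < μ)
    (hB : B ∈ Set.Ioo (0 : ℝ) (1/2)) :
    (∫ y in a..μ, ∫ z in (y + 2*(μ - y)*B)..μ,
        (2*(μ - y)) ^ k / ((k + 1) * (z - y) ^ k))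
    = (μ - a)^2/(k^2 - 1) * (B ^ (1 - k) - 2 ^ (k - 1)) := by
  have hinner : (∫ y in a..μ, ∫ z in (y + 2*(μ - y)*B)..μ,
        (2*(μ - y)) ^ k / ((k + 1) * (z - y) ^ k))
      = ∫ y in a..μ, 2 / (k ^ 2 - 1) * (B ^ (1 - k) - 2 ^ (k - 1)) * (μ - y) := by
    refine intervalIntegral.integral_congr fun y hy => ?_
    rw [uIcc_of_le haμ.le] at hy
    rcases hy.2.eq_or_lt with rfl | hlt
    · simp
    · have hshift := intervalIntegral.integral_comp_sub_right (a := y + 2*(μ - y)*B) (b := μ)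
        (fun u => (2*(μ - y)) ^ k / ((k + 1) * u ^ k)) y
      rw [add_sub_cancel_left] at hshift
      exact hshift.trans (integral_mul_rpow_div_rpow hk (sub_pos.2 hlt) hB.1)
  have hlin : (∫ y in a..μ, (μ - y)) = (μ - a) ^ 2 / 2 := by
    rw [intervalIntegral.integral_comp_sub_left (fun u => u) μ, integral_id]
    ring
  rw [hinner, intervalIntegral.integral_const_mul, hlin]
  ring
end

section
/- Let m ≥ 1 be an integer and x ∈ (0, 1). Then ∫_0^{m·x} t^{m/2 − 1} · e^{−t/2} / (2^{m/2} · Γ(m/2)) dt ≤ exp(−m·(x − 1 − log x)/2). In particular, for m ≥ 2 (corresponding to x = 1/m), ∫_0^{1} t^{m/2 − 1} e^{−t/2}/(2^{m/2}Γ(m/2)) dt ≤ m^{−m/2} · e^{(m+1)/2 − 1}. -/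
open MeasureTheory Set intervalIntegral

/-- The integrand of the Gamma integral with rate `r` is integrable on the positive half-line. -/
theorem integrableOn_rpow_mul_exp_neg_mul_Ioi {a r : ℝ} (ha : 0 < a) (hr : 0 < r) :
    IntegrableOn (fun t : ℝ => t ^ (a - 1) * Real.exp (-(r * t))) (Ioi 0) := by
  refine Integrable.of_integral_ne_zero ?_
  rw [Real.integral_rpow_mul_exp_neg_mul_Ioi ha hr]
  have := Real.Gamma_pos_of_pos ha
  positivity

/-- Chernoff's lower-tail bound for the Gamma distribution with shape `a` and rate `1 / 2`. -/
theorem integral_gamma_density_le {a x : ℝ} (ha : 0 < a) (hx : 0 < x) (hx1 : x ≤ 1) :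
    (∫ t in (0 : ℝ)..(2 * a * x),
        t ^ (a - 1) * Real.exp (-t / 2) / ((2 : ℝ) ^ a * Real.Gamma a))
      ≤ Real.exp (-(a * (x - 1 - Real.log x))) := by
  have hΓ := Real.Gamma_pos_of_pos ha
  have hr : 0 < 1 / (2 * x) := by positivity
  have hb : 0 ≤ 2 * a * x := by positivity
  have hint := integrableOn_rpow_mul_exp_neg_mul_Ioi ha hr
  have hint' : IntegrableOn (fun t : ℝ => t ^ (a - 1) * Real.exp (-t / 2)) (Ioi 0) := by
    refine (integrableOn_rpow_mul_exp_neg_mul_Ioi ha (one_half_pos (α := ℝ))).congr_fun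
      (fun t _ => ?_) measurableSet_Ioi
    ring_nf
  rw [intervalIntegral.integral_div, intervalIntegral.integral_of_le hb,
    div_le_iff₀ (by positivity)]
  calc ∫ t in Ioc 0 (2 * a * x), t ^ (a - 1) * Real.exp (-t / 2)
      ≤ ∫ t in Ioc 0 (2 * a * x),
          Real.exp (a * (1 - x)) * (t ^ (a - 1) * Real.exp (-(1 / (2 * x) * t))) := by
        refine setIntegral_mono_on (hint'.mono_set Ioc_subset_Ioi_self)
          ((hint.mono_set Ioc_subset_Ioi_self).const_mul _) measurableSet_Ioc fun t ht => ?_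
        rw [mul_left_comm, ← Real.exp_add]
        refine mul_le_mul_of_nonneg_left (Real.exp_le_exp.2 ?_) (Real.rpow_nonneg ht.1.le _)
        have h : a * (1 - x) + -(1 / (2 * x) * t) - -t / 2
            = (1 - x) * (2 * a * x - t) / (2 * x) := by
          field_simp
          ring
        have h' : 0 ≤ (1 - x) * (2 * a * x - t) / (2 * x) :=
          div_nonneg (mul_nonneg (sub_nonneg.2 hx1) (sub_nonneg.2 ht.2)) (by positivity)
        linarith
    _ = Real.exp (a * (1 - x)) *
          ∫ t in Ioc 0 (2 * a * x), t ^ (a - 1) * Real.exp (-(1 / (2 * x) * t)) :=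
        integral_const_mul _ _
    _ ≤ Real.exp (a * (1 - x)) *
          ∫ t in Ioi 0, t ^ (a - 1) * Real.exp (-(1 / (2 * x) * t)) := by
        refine mul_le_mul_of_nonneg_left (setIntegral_mono_set hint ?_
          Ioc_subset_Ioi_self.eventuallyLE) (Real.exp_pos _).le
        filter_upwards [ae_restrict_mem measurableSet_Ioi] with t ht
        exact mul_nonneg (Real.rpow_nonneg (le_of_lt ht) _) (Real.exp_pos _).le
    _ = Real.exp (-(a * (x - 1 - Real.log x))) * (2 ^ a * Real.Gamma a) := by
        rw [Real.integral_rpow_mul_exp_neg_mul_Ioi ha hr, one_div_one_div,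
          Real.mul_rpow zero_le_two hx.le, Real.rpow_def_of_pos hx,
          show -(a * (x - 1 - Real.log x)) = a * (1 - x) + Real.log x * a by ring, Real.exp_add]
        ring

/-- Chi-squared lower-tail bound: for `m ≥ 1` and `x ∈ (0,1)`, the CDF of the
chi-squared distribution with `m` degrees of freedom at `m·x` is at most
`exp(-m(x - 1 - log x)/2)`; in particular (taking `x = 1/m`) for `m ≥ 2`
the CDF at `1` is at most `m^(-m/2) e^((m+1)/2 - 1)`. -/
theorem stmt_12 :
    (∀ m : ℕ, 1 ≤ m → ∀ x : ℝ, x ∈ Set.Ioo (0 : ℝ) 1 →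
      (∫ t in (0:ℝ)..((m : ℝ) * x),
          t ^ ((m : ℝ)/2 - 1) * Real.exp (-t/2)
            / ((2 : ℝ) ^ ((m : ℝ)/2) * Real.Gamma ((m : ℝ)/2)))
        ≤ Real.exp (-((m : ℝ) * (x - 1 - Real.log x))/2)) ∧
    (∀ m : ℕ, 2 ≤ m →
      (∫ t in (0:ℝ)..1,
          t ^ ((m : ℝ)/2 - 1) * Real.exp (-t/2)
            / ((2 : ℝ) ^ ((m : ℝ)/2) * Real.Gamma ((m : ℝ)/2)))
        ≤ (m : ℝ) ^ (-(m : ℝ)/2) * Real.exp (((m : ℝ) + 1)/2 - 1)) := by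
  have chernoff (m : ℕ) (hm : 1 ≤ m) (x : ℝ) (hx : x ∈ Set.Ioo (0 : ℝ) 1) :
      (∫ t in (0:ℝ)..((m : ℝ) * x),
          t ^ ((m : ℝ)/2 - 1) * Real.exp (-t/2)
            / ((2 : ℝ) ^ ((m : ℝ)/2) * Real.Gamma ((m : ℝ)/2)))
        ≤ Real.exp (-((m : ℝ) * (x - 1 - Real.log x))/2) := by
    have hm0 : (0 : ℝ) < m := by exact_mod_cast hm
    convert integral_gamma_density_le (half_pos hm0) hx.1 hx.2.le using 2 <;> ring
  refine ⟨chernoff, fun m hm => ?_⟩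
  have hm0 : (0 : ℝ) < m := by exact_mod_cast (by omega : 0 < m)
  have hm1 : (1 : ℝ) < m := by exact_mod_cast hm
  convert chernoff m (by omega) (m : ℝ)⁻¹ ⟨inv_pos.2 hm0, inv_lt_one_of_one_lt₀ hm1⟩ using 1
  · rw [mul_inv_cancel₀ hm0.ne']
  · rw [Real.rpow_def_of_pos hm0, ← Real.exp_add, Real.log_inv]
    congr 1
    field_simp
    ring
end

section
/- For every integer m ≥ 2, B(1/2, 1/(m+1)) − B(1/2, 1/m) ≥ 1. -/
open MeasureTheory

/-- The real and complex integrands of the Beta integral agree on `[0, 1]`. -/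
theorem ofReal_betaIntegrand (a b : ℝ) {x : ℝ} (hx₀ : 0 ≤ x) (hx₁ : x ≤ 1) :
    ((x ^ (a - 1) * (1 - x) ^ (b - 1) : ℝ) : ℂ) =
      (x : ℂ) ^ ((a : ℂ) - 1) * (1 - (x : ℂ)) ^ ((b : ℂ) - 1) := by
  rw [Complex.ofReal_mul, Complex.ofReal_cpow hx₀, Complex.ofReal_cpow (sub_nonneg.2 hx₁)]
  push_cast
  rfl

theorem intervalIntegrable_betaIntegrand {a b : ℝ} (ha : 0 < a) (hb : 0 < b) :
    IntervalIntegrable (fun x : ℝ ↦ x ^ (a - 1) * (1 - x) ^ (b - 1)) volume 0 1 := by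
  have h := Complex.betaIntegral_convergent (u := a) (v := b) (by simpa) (by simpa)
  rw [intervalIntegrable_iff_integrableOn_Ioc_of_le zero_le_one] at h ⊢
  refine (integrableOn_congr_fun (fun x hx ↦ ?_) measurableSet_Ioc).1 h.re
  rw [← ofReal_betaIntegrand a b hx.1.le hx.2]
  exact Complex.ofReal_re _

theorem Beta_eq_integral {a b : ℝ} (ha : 0 < a) (hb : 0 < b) :
    Beta a b = ∫ x in (0 : ℝ)..1, x ^ (b - 1) * (1 - x) ^ (a - 1) := by
  have h : Complex.betaIntegral b a =
      ((∫ x in (0 : ℝ)..1, x ^ (b - 1) * (1 - x) ^ (a - 1) : ℝ) : ℂ) := by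
    rw [Complex.betaIntegral, ← intervalIntegral.integral_ofReal]
    refine intervalIntegral.integral_congr fun x hx ↦ ?_
    rw [Set.uIcc_of_le zero_le_one] at hx
    exact (ofReal_betaIntegrand b a hx.1 hx.2).symm
  have h' := ProbabilityTheory.beta_eq_betaIntegralReal a b ha hb
  rwa [← Complex.betaIntegral_symm, h, Complex.ofReal_re] at h'

theorem integral_rpow_sub_one {a : ℝ} (ha : 0 < a) :
    ∫ x in (0 : ℝ)..1, x ^ (a - 1) = 1 / a := by
  rw [integral_rpow (Or.inl (by linarith)), sub_add_cancel, Real.one_rpow,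
    Real.zero_rpow ha.ne', sub_zero]

/-- For `0 < c ≤ 1`, the function `b ↦ B(c, b) - 1 / b` is antitone on the positive reals. -/
theorem one_div_sub_one_div_le_Beta_sub_Beta {a b c : ℝ} (ha : 0 < a) (hab : a ≤ b)
    (hc : 0 < c) (hc₁ : c ≤ 1) : 1 / a - 1 / b ≤ Beta c a - Beta c b := by
  have hb := ha.trans_le hab
  have hp {d : ℝ} (hd : 0 < d) :
      IntervalIntegrable (fun x : ℝ ↦ x ^ (d - 1)) volume 0 1 :=
    intervalIntegral.intervalIntegrable_rpow' (by linarith)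
  have hBa := intervalIntegrable_betaIntegrand ha hc
  have hBb := intervalIntegrable_betaIntegrand hb hc
  rw [Beta_eq_integral hc ha, Beta_eq_integral hc hb, ← integral_rpow_sub_one ha,
    ← integral_rpow_sub_one hb, ← intervalIntegral.integral_sub (hp ha) (hp hb),
    ← intervalIntegral.integral_sub hBa hBb]
  refine intervalIntegral.integral_mono_on_of_le_Ioo zero_le_one ((hp ha).sub (hp hb))
    (hBa.sub hBb) fun x hx ↦ ?_
  have hle : x ^ (b - 1) ≤ x ^ (a - 1) :=
    Real.rpow_le_rpow_of_exponent_ge hx.1 hx.2.le (by linarith)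
  have hone : 1 ≤ (1 - x) ^ (c - 1) :=
    Real.one_le_rpow_of_pos_of_le_one_of_nonpos (sub_pos.2 hx.2) (by linarith [hx.1])
      (by linarith)
  rw [← sub_mul]
  exact le_mul_of_one_le_right (sub_nonneg.2 hle) hone

/-- For every integer `m ≥ 2`, `B(1/2, 1/(m+1)) - B(1/2, 1/m) ≥ 1`. -/
theorem stmt_14 (m : ℕ) (hm : 2 ≤ m) :
    1 ≤ Beta (1/2) (1/((m : ℝ) + 1)) - Beta (1/2) (1/(m : ℝ)) := by
  have hm₀ : (0 : ℝ) < m := by exact_mod_cast (by lia : 0 < m)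
  have h := one_div_sub_one_div_le_Beta_sub_Beta (a := 1 / ((m : ℝ) + 1)) (b := 1 / (m : ℝ))
    (c := 1 / 2) (by positivity) (one_div_le_one_div_of_le hm₀ (by linarith)) (by norm_num)
    (by norm_num)
  rwa [one_div_one_div, one_div_one_div, add_sub_cancel_left] at h
end

section
/- For every integer m ≥ 1, B(1/2, 1/((m+1)·√(2(m+1)))) − B(1/2, 1/(m·√(2m))) ≥ √(2(m+1)). -/
theorem ofReal_beta_integrand {u v x : ℝ} (hx : x ∈ Set.Icc (0 : ℝ) 1) :
    ((x ^ (u - 1) * (1 - x) ^ (v - 1) : ℝ) : ℂ) =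
      (x : ℂ) ^ ((u : ℂ) - 1) * (1 - (x : ℂ)) ^ ((v : ℂ) - 1) := by
  push_cast [Complex.ofReal_cpow hx.1, Complex.ofReal_cpow (sub_nonneg.2 hx.2)]
  rfl

theorem intervalIntegrable_beta_integrand {u v : ℝ} (hu : 0 < u) (hv : 0 < v) :
    IntervalIntegrable (fun x : ℝ => x ^ (u - 1) * (1 - x) ^ (v - 1))
      MeasureTheory.volume 0 1 := by
  have h := Complex.betaIntegral_convergent (u := u) (v := v) (by simpa) (by simpa)
  rw [intervalIntegrable_iff_integrableOn_Ioc_of_le zero_le_one] at h ⊢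
  refine h.re.congr ?_
  filter_upwards [MeasureTheory.ae_restrict_mem measurableSet_Ioc] with x hx
  simp [← ofReal_beta_integrand (u := u) (v := v) (Set.Ioc_subset_Icc_self hx), -Complex.ofReal_mul]

theorem Beta_eq_integral_s15 {u v : ℝ} (hu : 0 < u) (hv : 0 < v) :
    Beta u v = ∫ x in (0 : ℝ)..1, x ^ (u - 1) * (1 - x) ^ (v - 1) := by
  have h : Complex.betaIntegral u v =
      ((∫ x in (0 : ℝ)..1, x ^ (u - 1) * (1 - x) ^ (v - 1) : ℝ) : ℂ) := by
    rw [← intervalIntegral.integral_ofReal, Complex.betaIntegral]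
    refine intervalIntegral.integral_congr fun x hx => ?_
    rw [Set.uIcc_of_le zero_le_one] at hx
    exact (ofReal_beta_integrand hx).symm
  have h' := ProbabilityTheory.beta_eq_betaIntegralReal u v hu hv
  rw [h, Complex.ofReal_re] at h'
  exact h'

theorem Beta_comm (u v : ℝ) : Beta u v = Beta v u := by
  simp only [Beta, mul_comm, add_comm]

theorem Beta_one_left {b : ℝ} (hb : 0 < b) : Beta 1 b = 1 / b := by
  have := (Real.Gamma_pos_of_pos hb).ne'
  rw [Beta, Real.Gamma_one, add_comm, Real.Gamma_add_one hb.ne']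
  field_simp

theorem Beta_sub_Beta_anti {a c x y : ℝ} (ha : 0 < a) (hac : a ≤ c) (hx : 0 < x) (hxy : x ≤ y) :
    Beta c x - Beta c y ≤ Beta a x - Beta a y := by
  have hc := ha.trans_le hac
  have hy := hx.trans_le hxy
  rw [Beta_comm c, Beta_comm c, Beta_comm a, Beta_comm a,
    Beta_eq_integral_s15 hx hc, Beta_eq_integral_s15 hy hc, Beta_eq_integral_s15 hx ha, Beta_eq_integral_s15 hy ha]
  have ixc := intervalIntegrable_beta_integrand hx hc
  have iyc := intervalIntegrable_beta_integrand hy hc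
  have ixa := intervalIntegrable_beta_integrand hx ha
  have iya := intervalIntegrable_beta_integrand hy ha
  rw [← intervalIntegral.integral_sub ixc iyc, ← intervalIntegral.integral_sub ixa iya]
  refine intervalIntegral.integral_mono_on_of_le_Ioo zero_le_one
    (ixc.sub iyc) (ixa.sub iya) fun t ht => ?_
  rw [← sub_mul, ← sub_mul]
  refine mul_le_mul_of_nonneg_left ?_ (sub_nonneg.2 ?_)
  · exact Real.rpow_le_rpow_of_exponent_ge (by linarith [ht.2]) (by linarith [ht.1]) (by linarith)
  · exact Real.rpow_le_rpow_of_exponent_ge ht.1 ht.2.le (by linarith)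

/-- For every integer `m ≥ 1`,
`B(1/2, 1/((m+1)√(2(m+1)))) - B(1/2, 1/(m√(2m))) ≥ √(2(m+1))`. -/
theorem stmt_15 (m : ℕ) (hm : 1 ≤ m) :
    Real.sqrt (2 * ((m : ℝ) + 1))
      ≤ Beta (1/2) (1/(((m : ℝ) + 1) * Real.sqrt (2 * ((m : ℝ) + 1))))
        - Beta (1/2) (1/((m : ℝ) * Real.sqrt (2 * (m : ℝ)))) := by
  have hm0 : (0 : ℝ) < m := by exact_mod_cast hm
  have hs : Real.sqrt (2 * (m : ℝ)) ≤ Real.sqrt (2 * ((m : ℝ) + 1)) :=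
    Real.sqrt_le_sqrt (by linarith)
  have hs0 : 0 < Real.sqrt (2 * (m : ℝ)) := Real.sqrt_pos.2 (by linarith)
  have hs1 := hs0.trans_le hs
  have key := Beta_sub_Beta_anti (a := 1 / 2) (c := 1) (by norm_num) (by norm_num)
    (x := 1 / (((m : ℝ) + 1) * Real.sqrt (2 * ((m : ℝ) + 1))))
    (y := 1 / ((m : ℝ) * Real.sqrt (2 * (m : ℝ)))) (by positivity)
    (one_div_le_one_div_of_le (by positivity) (by gcongr; linarith))
  rw [Beta_one_left (by positivity), Beta_one_left (by positivity), one_div_one_div,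
    one_div_one_div] at key
  nlinarith [mul_le_mul_of_nonneg_left hs hm0.le]
end

section
/- Let n ≥ 2 be an integer and k a real number. Then the double integral ∫_{u ∈ (0,∞)} √(n/(2π)) · e^{−n u²/2} · ∫_{s ∈ (1,∞)} (1 + n u²/s)^{(n+k−2)/2} · s^{(n−3)/2} · e^{−s/2} / (2^{(n−1)/2} Γ((n−1)/2)) ds du equals (1/(2√π · Γ((n−1)/2))) · ∫_0^1 w^{−1/2} (1−w)^{−(k+1)/2} · Γ(n/2, 1/(2(1−w))) dw. -/
open MeasureTheory Set

/-- A nonnegative iterated Bochner integral with integrable sections is the iterated lower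
Lebesgue integral. -/
lemma setIntegral_setIntegral_eq_toReal_lintegral {F : ℝ → ℝ → ℝ} {S T : Set ℝ}
    (hS : MeasurableSet S) (hT : MeasurableSet T) (hF : Measurable (Function.uncurry F))
    (hpos : ∀ x ∈ S, ∀ y ∈ T, 0 ≤ F x y) (hint : ∀ x ∈ S, IntegrableOn (F x) T) :
    ∫ x in S, ∫ y in T, F x y
      = (∫⁻ x in S, ∫⁻ y in T, ENNReal.ofReal (F x y)).toReal := by
  have hsm : StronglyMeasurable fun x => ∫ y in T, F x y :=
    hF.stronglyMeasurable.integral_prod_right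
  rw [integral_eq_lintegral_of_nonneg_ae _ hsm.aestronglyMeasurable]
  · congr 1
    refine setLIntegral_congr_fun hS fun x hx => ?_
    refine ofReal_integral_eq_lintegral_ofReal (hint x hx) ?_
    filter_upwards [ae_restrict_mem hT] with y hy using hpos x hx y hy
  · filter_upwards [ae_restrict_mem hS] with x hx
    exact setIntegral_nonneg hT fun y hy => hpos x hx y hy

lemma lintegral_lintegral_setSwap {F : ℝ → ℝ → ℝ} {S T : Set ℝ}
    (hF : Measurable (Function.uncurry F)) :
    ∫⁻ x in S, ∫⁻ y in T, ENNReal.ofReal (F x y)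
      = ∫⁻ y in T, ∫⁻ x in S, ENNReal.ofReal (F x y) :=
  lintegral_lintegral_swap (f := fun x y => ENNReal.ofReal (F x y))
    (ENNReal.measurable_ofReal.comp hF).aemeasurable

/-- The change of variables `u = √(c w / (1 - w))` from `(0, 1)` to `(0, ∞)`. -/
lemma setLIntegral_Ioi_eq_Ioo_sqrt_div {c : ℝ} (hc : 0 < c) (f : ℝ → ENNReal) :
    ∫⁻ u in Ioi (0 : ℝ), f u
      = ∫⁻ w in Ioo (0 : ℝ) 1,
          ENNReal.ofReal (c / (1 - w) ^ 2 / (2 * √(c * w / (1 - w)))) *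
            f (√(c * w / (1 - w))) := by
  have himg : image (fun w : ℝ => √(c * w / (1 - w))) (Ioo 0 1) = Ioi 0 := by
    ext u
    simp only [mem_image, mem_Ioo, mem_Ioi]
    constructor
    · rintro ⟨w, ⟨h0, h1⟩, rfl⟩
      have : 0 < 1 - w := by linarith
      positivity
    · intro hu
      refine ⟨u ^ 2 / (c + u ^ 2), ⟨by positivity, ?_⟩, ?_⟩
      · rw [div_lt_one (by positivity)]
        linarith
      · have : c * (u ^ 2 / (c + u ^ 2)) / (1 - u ^ 2 / (c + u ^ 2)) = u ^ 2 := by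
          have h1 : 1 - u ^ 2 / (c + u ^ 2) = c / (c + u ^ 2) := by
            field_simp
            ring
          rw [h1]
          field_simp
        rw [this, Real.sqrt_sq hu.le]
  have hinj : InjOn (fun w : ℝ => √(c * w / (1 - w))) (Ioo 0 1) := by
    rintro x ⟨hx0, hx1⟩ y ⟨hy0, hy1⟩ hxy
    have hx : 0 < 1 - x := by linarith
    have hy : 0 < 1 - y := by linarith
    have h := (Real.sqrt_inj (by positivity) (by positivity)).1 hxy
    rw [div_eq_div_iff hx.ne' hy.ne'] at h
    have : c * (x - y) = 0 := by linarith
    rcases mul_eq_zero.1 this with h | h <;> linarith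
  have hder : ∀ w ∈ Ioo (0 : ℝ) 1, HasDerivWithinAt (fun w : ℝ => √(c * w / (1 - w)))
      (c / (1 - w) ^ 2 / (2 * √(c * w / (1 - w)))) (Ioo 0 1) w := by
    rintro w ⟨h0, h1⟩
    have hw : 0 < 1 - w := by linarith
    have hd : HasDerivAt (fun w : ℝ => c * w / (1 - w)) (c / (1 - w) ^ 2) w := by
      have h := ((hasDerivAt_id w).const_mul c).div ((hasDerivAt_id w).const_sub 1) hw.ne'
      refine h.congr_deriv ?_
      simp only [id]
      ring
    exact (hd.sqrt (by positivity)).hasDerivWithinAt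
  rw [← himg, lintegral_image_eq_lintegral_abs_deriv_mul measurableSet_Ioo hder hinj]
  refine setLIntegral_congr_fun measurableSet_Ioo fun w hw => ?_
  have hw' : 0 < 1 - w := by linarith [hw.2]
  rw [abs_of_nonneg (by positivity)]

lemma uGamma_eq_integral_Ioi_one (a : ℝ) {c : ℝ} (hc : 0 < c) :
    uGamma a c = ∫ s in Ioi (1 : ℝ), c * ((c * s) ^ (a - 1) * Real.exp (-(c * s))) := by
  have h := integral_comp_mul_left_Ioi (fun t => t ^ (a - 1) * Real.exp (-t)) 1 hc
  rw [integral_const_mul, h, mul_one, smul_eq_mul, uGamma, mul_inv_cancel_left₀ hc.ne']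

lemma integrableOn_one_add_div_rpow_mul_rpow_mul_exp {a q : ℝ} (p : ℝ) (ha : 0 ≤ a)
    (hq : -1 < q) :
    IntegrableOn (fun s : ℝ => (1 + a / s) ^ p * s ^ q * Real.exp (-s / 2)) (Ioi 1) := by
  have h := ((integrableOn_rpow_mul_exp_neg_mul_rpow hq one_pos (b := 1 / 2)
    (by norm_num)).mono_set (Ioi_subset_Ioi zero_le_one)).const_mul ((1 + a) ^ |p|)
  refine Integrable.mono' h (by fun_prop) ?_
  filter_upwards [ae_restrict_mem measurableSet_Ioi] with s hs
  have hs1 : (1 : ℝ) < s := hs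
  have hs0 : 0 < s := by linarith
  have h1 : 1 ≤ 1 + a / s := by
    have : 0 ≤ a / s := by positivity
    linarith
  have h2 : a / s ≤ a := div_le_self ha hs1.le
  rw [Real.norm_of_nonneg (by positivity), Real.rpow_one, mul_assoc,
    show -s / 2 = -(1 / 2) * s by ring]
  gcongr
  exact (Real.rpow_le_rpow_of_exponent_le h1 (le_abs_self p)).trans
    (Real.rpow_le_rpow (by linarith) (by linarith) (abs_nonneg p))

lemma gaussian_chiSq_density_change_of_variables {N s w g : ℝ} (k : ℝ) (hN : 0 < N)
    (hs : 0 < s) (hw0 : 0 < w) (hw1 : w < 1) (hg : 0 < g) :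
    s / N / (1 - w) ^ 2 / (2 * √(s / N * w / (1 - w))) *
      (√(N / (2 * Real.pi)) * Real.exp (-(N * √(s / N * w / (1 - w)) ^ 2) / 2) *
        ((1 + N * √(s / N * w / (1 - w)) ^ 2 / s) ^ ((N + k - 2) / 2) * s ^ ((N - 3) / 2)
          * Real.exp (-s / 2) / ((2 : ℝ) ^ ((N - 1) / 2) * g)))
    = 1 / (2 * √Real.pi * g) * (w ^ (-(1 : ℝ) / 2) * (1 - w) ^ (-(k + 1) / 2) *
        (1 / (2 * (1 - w)) * ((1 / (2 * (1 - w)) * s) ^ (N / 2 - 1)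
          * Real.exp (-(1 / (2 * (1 - w)) * s))))) := by
  obtain ⟨v, rfl⟩ : ∃ v, w = 1 - v := ⟨1 - w, by ring⟩
  have hv : 0 < v := by linarith
  rw [sub_sub_cancel, Real.sq_sqrt (by positivity)]
  have h1 : 1 + N * (s / N * (1 - v) / v) / s = v⁻¹ := by
    field_simp
    ring
  rw [h1]
  have hpi := Real.pi_pos
  apply Real.log_injOn_pos
  · exact mem_Ioi.2 (by positivity)
  · exact mem_Ioi.2 (by positivity)
  generalize hwv : 1 - v = w at hw0 ⊢
  simp (disch := positivity) only [Real.log_mul, Real.log_div, Real.log_exp, Real.log_sqrt,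
    Real.log_rpow, Real.log_pow, Real.log_inv, Real.log_one]
  field_simp
  rw [← hwv]
  ring

/-- Change of variables `(u, s) = (√(2zw/n), 2z(1-w))` in the bad-optimal-arm
term of TS-T in the Gaussian bandit: the Gaussian/chi-squared double integral
equals an integral of the upper incomplete gamma function. -/
theorem stmt_18 (n : ℕ) (hn : 2 ≤ n) (k : ℝ) :
    (∫ u in Set.Ioi (0 : ℝ),
        Real.sqrt ((n : ℝ)/(2 * Real.pi)) * Real.exp (-((n : ℝ) * u^2)/2) *
        ∫ s in Set.Ioi (1 : ℝ),
          (1 + (n : ℝ) * u^2 / s) ^ (((n : ℝ) + k - 2)/2)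
            * s ^ (((n : ℝ) - 3)/2) * Real.exp (-s/2)
            / ((2 : ℝ) ^ (((n : ℝ) - 1)/2) * Real.Gamma (((n : ℝ) - 1)/2)))
    = (1/(2 * Real.sqrt Real.pi * Real.Gamma (((n : ℝ) - 1)/2))) *
        ∫ w in Set.Ioo (0 : ℝ) 1,
          w ^ (-(1:ℝ)/2) * (1 - w) ^ (-(k + 1)/2)
            * uGamma ((n : ℝ)/2) (1/(2*(1 - w))) := by
  have hN : (2 : ℝ) ≤ n := by exact_mod_cast hn
  generalize (n : ℝ) = N at hN ⊢
  have hN0 : 0 < N := by linarith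
  have hg : 0 < Real.Gamma ((N - 1) / 2) := Real.Gamma_pos_of_pos (by linarith)
  generalize Real.Gamma ((N - 1) / 2) = g at hg ⊢
  have hR : ∀ w ∈ Ioo (0 : ℝ) 1,
      w ^ (-(1 : ℝ) / 2) * (1 - w) ^ (-(k + 1) / 2) * uGamma (N / 2) (1 / (2 * (1 - w)))
        = ∫ s in Ioi (1 : ℝ), w ^ (-(1 : ℝ) / 2) * (1 - w) ^ (-(k + 1) / 2) *
            (1 / (2 * (1 - w)) * ((1 / (2 * (1 - w)) * s) ^ (N / 2 - 1)
              * Real.exp (-(1 / (2 * (1 - w)) * s)))) := by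
    intro w hw
    have hw' : 0 < 1 - w := by linarith [hw.2]
    rw [uGamma_eq_integral_Ioi_one _ (by positivity : 0 < 1 / (2 * (1 - w))),
      ← integral_const_mul]
  rw [setIntegral_congr_fun measurableSet_Ioo hR, ← integral_const_mul]
  simp_rw [← integral_const_mul]
  rw [setIntegral_setIntegral_eq_toReal_lintegral measurableSet_Ioi measurableSet_Ioi,
    setIntegral_setIntegral_eq_toReal_lintegral measurableSet_Ioo measurableSet_Ioi]
  · rw [lintegral_lintegral_setSwap (S := Ioi 0), lintegral_lintegral_setSwap (S := Ioo 0 1)]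
    · congr 1
      refine setLIntegral_congr_fun measurableSet_Ioi fun s hs => ?_
      have hs0 : 0 < s := zero_lt_one.trans hs
      rw [setLIntegral_Ioi_eq_Ioo_sqrt_div (div_pos hs0 hN0)]
      refine setLIntegral_congr_fun measurableSet_Ioo fun w hw => ?_
      have hw0 := hw.1
      have hw' : 0 < 1 - w := by linarith [hw.2]
      rw [← ENNReal.ofReal_mul (by positivity),
        gaussian_chiSq_density_change_of_variables k hN0 hs0 hw.1 hw.2 hg]
    · simp only [Function.uncurry_def]
      fun_prop
    · simp only [Function.uncurry_def]
      fun_prop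
  · simp only [Function.uncurry_def]
    fun_prop
  · rintro w ⟨hw0, hw1⟩ s hs
    have hs0 : 0 < s := zero_lt_one.trans hs
    have hw' : 0 < 1 - w := by linarith
    positivity
  · rintro w ⟨hw0, hw1⟩
    have hc : 0 < 1 / (2 * (1 - w)) := by
      have : 0 < 1 - w := by linarith
      positivity
    have h := Real.GammaIntegral_convergent (s := N / 2) (by linarith)
    have h' : IntegrableOn (fun t : ℝ => t ^ (N / 2 - 1) * Real.exp (-t))
        (Ioi (1 / (2 * (1 - w)) * 1)) := by
      refine (h.mono_set (Ioi_subset_Ioi (by simpa using hc.le))).congr_fun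
        (fun t _ => mul_comm _ _) measurableSet_Ioi
    exact ((((integrableOn_Ioi_comp_mul_left_iff (fun t : ℝ => t ^ (N / 2 - 1) * Real.exp (-t)) 1 hc).2 h').const_mul _).const_mul _).const_mul _
  · simp only [Function.uncurry_def]
    fun_prop
  · intro u hu s hs
    have hs0 : 0 < s := zero_lt_one.trans hs
    positivity
  · intro u hu
    exact ((integrableOn_one_add_div_rpow_mul_rpow_mul_exp ((N + k - 2) / 2)
      (by positivity) (by linarith)).div_const _).const_mul _
end

section
/- For every integer m ≥ 2, (1/(2^m · √e)) · ∫_0^∞ t^{−1/2} · (1 + t)^{m − 1/2} · e^{−t/2} dt ≤ Γ(m + 1). -/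
open MeasureTheory Set

/-- The integrand `t^(-1/2) (1+t)^a e^(-t/2)`. -/
noncomputable def gammaKernel (a t : ℝ) : ℝ :=
  t ^ (-(1:ℝ)/2) * (1 + t) ^ a * Real.exp (-t/2)

lemma gammaKernel_nonneg (a : ℝ) {t : ℝ} (ht : 0 < t) : 0 ≤ gammaKernel a t := by
  unfold gammaKernel; positivity

lemma gammaKernel_add_one (a : ℝ) {t : ℝ} (ht : 0 < t) :
    gammaKernel (a + 1) t = (1 + t) * gammaKernel a t := by
  have h : (0:ℝ) < 1 + t := by linarith
  rw [gammaKernel, gammaKernel, Real.rpow_add_one h.ne']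
  ring

lemma continuousOn_gammaKernel (a : ℝ) : ContinuousOn (gammaKernel a) (Ioi 0) := by
  intro t (ht : 0 < t)
  have h : (1:ℝ) + t ≠ 0 := by linarith
  refine ContinuousAt.continuousWithinAt ?_
  unfold gammaKernel
  exact ((Real.continuousAt_rpow_const t _ (Or.inl ht.ne')).mul
    ((continuousAt_const.add continuousAt_id).rpow_const (Or.inl h))).mul (by fun_prop)

lemma integrableOn_rpow_mul_exp {b : ℝ} (hb : 0 < b) :
    IntegrableOn (fun t : ℝ => t ^ (-(1:ℝ)/2) * Real.exp (-b * t)) (Ioi 0) := by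
  simpa using integrableOn_rpow_mul_exp_neg_mul_rpow (s := -(1:ℝ)/2) (p := 1)
    (by norm_num) one_pos hb

lemma integrableOn_gammaKernel (a : ℝ) : IntegrableOn (gammaKernel a) (Ioi 0) := by
  obtain ⟨n, hn⟩ := exists_nat_ge a
  refine Integrable.mono' ((integrableOn_rpow_mul_exp (b := 1/4) (by norm_num)).const_mul
    (4 ^ n * n.factorial * Real.exp (1/4)))
    ((continuousOn_gammaKernel a).aestronglyMeasurable measurableSet_Ioi) ?_
  filter_upwards [ae_restrict_mem measurableSet_Ioi] with t ht
  have ht : 0 < t := ht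
  rw [Real.norm_of_nonneg (gammaKernel_nonneg a ht)]
  have hpow : (1 + t) ^ a ≤ 4 ^ n * n.factorial * Real.exp ((1 + t) / 4) := by
    calc (1 + t) ^ a ≤ (1 + t) ^ (n : ℝ) :=
          Real.rpow_le_rpow_of_exponent_le (by linarith) hn
      _ = (1 + t) ^ n := Real.rpow_natCast _ _
      _ = 4 ^ n * n.factorial * (((1 + t) / 4) ^ n / n.factorial) := by
          rw [div_pow]; field_simp
      _ ≤ _ := by
          gcongr
          exact Real.pow_div_factorial_le_exp _ (by positivity) n
  calc gammaKernel a t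
      ≤ t ^ (-(1:ℝ)/2) * (4 ^ n * n.factorial * Real.exp ((1 + t) / 4)) * Real.exp (-t/2) := by
        unfold gammaKernel; gcongr
    _ = 4 ^ n * n.factorial * t ^ (-(1:ℝ)/2) * (Real.exp ((1 + t) / 4) * Real.exp (-t/2)) := by
        ring
    _ = 4 ^ n * n.factorial * t ^ (-(1:ℝ)/2) * (Real.exp (1/4) * Real.exp (-(1/4) * t)) := by
        rw [← Real.exp_add, ← Real.exp_add]; ring_nf
    _ = _ := by ring

lemma gammaKernel_eq_sub (a : ℝ) {t : ℝ} (ht : 0 < t) :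
    t ^ ((1:ℝ)/2) * (1 + t) ^ a * Real.exp (-t/2) = gammaKernel (a + 1) t - gammaKernel a t := by
  have h : t ^ ((1:ℝ)/2) = t ^ (-(1:ℝ)/2) * t := by
    rw [← Real.rpow_add_one ht.ne']; norm_num
  rw [gammaKernel_add_one a ht, h, gammaKernel]
  ring

lemma hasDerivAt_rpow_mul_rpow_mul_exp (a : ℝ) {t : ℝ} (ht : 0 < t) :
    HasDerivAt (fun t : ℝ => t ^ ((1:ℝ)/2) * (1 + t) ^ a * Real.exp (-t/2))
      (-(1/2) * gammaKernel (a + 1) t + (a + 1) * gammaKernel a t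
        - a * gammaKernel (a - 1) t) t := by
  have hs : (0:ℝ) < 1 + t := by linarith
  have h1 := Real.hasDerivAt_rpow_const (x := t) (p := 1/2) (Or.inl ht.ne')
  have h2 := ((hasDerivAt_id t).const_add 1).rpow_const (p := a) (Or.inl hs.ne')
  have h3 := ((hasDerivAt_id t).neg.div_const 2).exp
  refine ((h1.mul h2).mul h3).congr_deriv ?_
  have e1 : t ^ ((1:ℝ)/2) = t ^ (-(1:ℝ)/2) * t := by
    rw [← Real.rpow_add_one ht.ne']; norm_num
  have e2 : (1 + t) ^ a = (1 + t) ^ (a - 1) * (1 + t) := by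
    rw [← Real.rpow_add_one hs.ne']; ring_nf
  have e3 : (1:ℝ)/2 - 1 = -(1:ℝ)/2 := by norm_num
  rw [gammaKernel_add_one a ht]
  simp only [gammaKernel, id, Pi.neg_apply, Pi.mul_apply, e1, e2, e3]
  ring

/-- Three-term recurrence for the integrals of `gammaKernel`, by integration by parts. -/
lemma integral_gammaKernel_recurrence (a : ℝ) :
    ∫ t in Ioi (0:ℝ), gammaKernel (a + 1) t =
      2 * (a + 1) * (∫ t in Ioi (0:ℝ), gammaKernel a t)
        - 2 * a * ∫ t in Ioi (0:ℝ), gammaKernel (a - 1) t := by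
  have i1 := (integrableOn_gammaKernel (a + 1)).const_mul (-(1/2))
  have i2 := (integrableOn_gammaKernel a).const_mul (a + 1)
  have i3 := (integrableOn_gammaKernel (a - 1)).const_mul a
  have i12 : IntegrableOn
      (fun t => -(1/2) * gammaKernel (a + 1) t + (a + 1) * gammaKernel a t) (Ioi 0) := i1.add i2
  have hint : IntegrableOn (fun t : ℝ => t ^ ((1:ℝ)/2) * (1 + t) ^ a * Real.exp (-t/2))
      (Ioi 0) :=
    ((integrableOn_gammaKernel (a + 1)).sub (integrableOn_gammaKernel a)).congr_fun
      (fun t ht => (gammaKernel_eq_sub a ht).symm) measurableSet_Ioi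
  have hlim := tendsto_zero_of_hasDerivAt_of_integrableOn_Ioi
    (fun t ht => hasDerivAt_rpow_mul_rpow_mul_exp a ht) (i12.sub i3) hint
  have hcont : ContinuousWithinAt
      (fun t : ℝ => t ^ ((1:ℝ)/2) * (1 + t) ^ a * Real.exp (-t/2)) (Ici 0) 0 := by
    refine ContinuousAt.continuousWithinAt ?_
    exact ((Real.continuousAt_rpow_const 0 _ (Or.inr (by norm_num))).mul
      ((continuousAt_const.add continuousAt_id).rpow_const (Or.inl (by simp)))).mul (by fun_prop)
  have h := integral_Ioi_of_hasDerivAt_of_tendsto hcont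
    (fun t ht => hasDerivAt_rpow_mul_rpow_mul_exp a ht) (i12.sub i3) hlim
  have hz : (0:ℝ) ^ ((1:ℝ)/2) = 0 := Real.zero_rpow (by norm_num)
  rw [integral_sub i12 i3, integral_add i1 i2, integral_const_mul, integral_const_mul,
    integral_const_mul, hz] at h
  linarith

lemma integral_gammaKernel_nonneg (a : ℝ) : 0 ≤ ∫ t in Ioi (0:ℝ), gammaKernel a t :=
  setIntegral_nonneg measurableSet_Ioi fun _ ht => gammaKernel_nonneg a ht

lemma integral_gammaKernel_zero :
    ∫ t in Ioi (0:ℝ), gammaKernel 0 t = √(2 * Real.pi) := by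
  have h := Real.integral_rpow_mul_exp_neg_mul_Ioi (a := 1/2) (r := 1/2)
    (by norm_num) (by norm_num)
  rw [Real.Gamma_one_half_eq] at h
  have e : (1 / (1/2) : ℝ) ^ ((1:ℝ)/2) = √2 := by rw [Real.sqrt_eq_rpow]; norm_num
  rw [e, ← Real.sqrt_mul (by norm_num)] at h
  rw [← h]
  refine setIntegral_congr_fun measurableSet_Ioi fun t _ => ?_
  simp only [gammaKernel, Real.rpow_zero, mul_one]
  congr 2 <;> ring

lemma integral_gammaKernel_three_halves_le :
    ∫ t in Ioi (0:ℝ), gammaKernel (3/2) t ≤ 8 * √(Real.exp 1) := by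
  have h1 := integral_gammaKernel_recurrence 0
  have h2 := integral_gammaKernel_recurrence 1
  norm_num at h1 h2
  rw [h1, integral_gammaKernel_zero] at h2
  rw [integral_gammaKernel_zero] at h1
  have i1 := integrableOn_gammaKernel 1
  have i2 := (integrableOn_gammaKernel 2).const_mul (1/4)
  have hle : ∫ t in Ioi (0:ℝ), gammaKernel (3/2) t ≤
      ∫ t in Ioi (0:ℝ), (gammaKernel 1 t + 1/4 * gammaKernel 2 t) := by
    refine setIntegral_mono_on (integrableOn_gammaKernel _) (i1.add i2) measurableSet_Ioi ?_
    intro t (ht : 0 < t)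
    have hs : (0:ℝ) < 1 + t := by linarith
    have e1 : gammaKernel 2 t = (1 + t) * gammaKernel 1 t := by
      rw [← gammaKernel_add_one 1 ht]; norm_num
    have e2 : gammaKernel (3/2) t = √(1 + t) * gammaKernel 1 t := by
      rw [gammaKernel, gammaKernel, show (3/2 : ℝ) = 1/2 + 1 by norm_num,
        Real.rpow_add hs, Real.sqrt_eq_rpow]
      ring
    have hsq : √(1 + t) ≤ 1 + (1 + t) / 4 := by
      nlinarith [Real.sq_sqrt hs.le, sq_nonneg (√(1 + t) - 2)]
    rw [e1, e2]
    nlinarith [mul_le_mul_of_nonneg_right hsq (gammaKernel_nonneg 1 ht)]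
  rw [integral_add i1 i2, integral_const_mul, h1, h2] at hle
  have hsqrt : √(2 * Real.pi) ≤ 2 * √(Real.exp 1) := by
    rw [show (2:ℝ) * √(Real.exp 1) = √(4 * Real.exp 1) by
      rw [Real.sqrt_mul (by norm_num), show (4:ℝ) = 2 ^ 2 by norm_num,
        Real.sqrt_sq (by norm_num)]]
    exact Real.sqrt_le_sqrt (by linarith [Real.pi_le_four, Real.add_one_le_exp (1:ℝ)])
  linarith [Real.sqrt_nonneg (Real.exp 1)]

lemma integral_gammaKernel_le (m : ℕ) (hm : 2 ≤ m) :
    ∫ t in Ioi (0:ℝ), gammaKernel (m - 1/2) t ≤ 2 ^ m * √(Real.exp 1) * m.factorial := by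
  induction m, hm using Nat.le_induction with
  | base =>
    have h := integral_gammaKernel_three_halves_le
    norm_num [Nat.factorial] at h ⊢
    linarith
  | succ m hm ih =>
    have h := integral_gammaKernel_recurrence (m - 1/2)
    have hm' : (2:ℝ) ≤ m := by exact_mod_cast hm
    have h0 := integral_gammaKernel_nonneg (m - 1/2)
    have h1 := mul_nonneg (show (0:ℝ) ≤ 2 * (m - 1/2) by linarith)
      (integral_gammaKernel_nonneg (m - 1/2 - 1))
    rw [show ((m + 1 : ℕ) : ℝ) - 1/2 = m - 1/2 + 1 by push_cast; ring, h]
    calc _ ≤ 2 * ((m:ℝ) + 1) * ∫ t in Ioi (0:ℝ), gammaKernel (m - 1/2) t := by linarith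
      _ ≤ 2 * ((m:ℝ) + 1) * (2 ^ m * √(Real.exp 1) * m.factorial) := by gcongr
      _ = _ := by rw [Nat.factorial_succ]; push_cast; ring

/-- Remainder term in the inductive step of the incomplete-gamma integral bound
for the Gaussian bandit analysis: for every integer `m ≥ 2`,
`(1/(2^m √e)) ∫₀^∞ t^(-1/2) (1+t)^(m-1/2) e^(-t/2) dt ≤ Γ(m+1)`. -/
theorem stmt_19 (m : ℕ) (hm : 2 ≤ m) :
    (1/((2 : ℝ) ^ m * Real.sqrt (Real.exp 1))) *
      ∫ t in Set.Ioi (0 : ℝ),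
        t ^ (-(1:ℝ)/2) * (1 + t) ^ ((m : ℝ) - 1/2) * Real.exp (-t/2)
    ≤ Real.Gamma ((m : ℝ) + 1) := by
  rw [Real.Gamma_nat_eq_factorial, one_div, inv_mul_le_iff₀ (by positivity)]
  exact integral_gammaKernel_le m hm
end
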